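/- arXiv:2510.14424 — 2 statements merged into one kernel-verified Lean document; each statement's English description precedes it below -/
import Mathlib

section
/- There exist real constants A > 0 and ε > 0 such that for every function k : ℕ → ℕ satisfying k(n) ≤ n for all n and lim_{n→∞} ( n²/4 − ε·n + A·√n − k(n)·(n − k(n)) ) = −∞ (condition (⋆)), the ratio N^S_{k(n),n} / N^S_n between the number of permutation equivalence classes of k(n)-dimensional linear codes in F_q^n and the total number of permutation equivalence classes of linear codes in F_q^n satisfies N^S_{k(n),n} / N^S_n ∼ p(k(n), n) := binom(n, k(n))_q / S(n) as n → ∞. -/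
open Filter Matrix
open scoped Topology

/-- The `q`-binomial coefficient `binom(n,k)_q = ∏_{j=0}^{k-1} (q^{n-j}-1)/(q^{k-j}-1)`. -/
noncomputable def qBinom (q n k : ℕ) : ℝ :=
  ∏ j ∈ Finset.range k, ((q : ℝ) ^ (n - j) - 1) / ((q : ℝ) ^ (k - j) - 1)

/-- `S(n) = ∑_{k=0}^n binom(n,k)_q`. -/
noncomputable def Sq (q n : ℕ) : ℝ := ∑ k ∈ Finset.range (n + 1), qBinom q n k

/-- `K_q = ∏_{j=1}^∞ (1 - q^{-j})`. -/
noncomputable def Kq (q : ℕ) : ℝ := ∏' j : ℕ, (1 - ((q : ℝ))⁻¹ ^ (j + 1))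

/-- `K_q(k) = ∏_{j=1}^{k} (1 - q^{-j})`. -/
noncomputable def KqTrunc (q k : ℕ) : ℝ := ∏ j ∈ Finset.range k, (1 - ((q : ℝ))⁻¹ ^ (j + 1))

/-- Jacobi theta constant `θ₂(w) = ∑_{k∈ℤ} w^{(k+1/2)²}`. -/
noncomputable def theta2 (w : ℝ) : ℝ := ∑' k : ℤ, w ^ (((k : ℝ) + 1/2) ^ 2)

/-- Jacobi theta constant `θ₃(w) = ∑_{k∈ℤ} w^{k²}`. -/
noncomputable def theta3 (w : ℝ) : ℝ := ∑' k : ℤ, w ^ ((k : ℝ) ^ 2)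

/-- Condition (⋆): `n²/4 − ε·n + A·√n − k(n)(n−k(n)) → −∞`. -/
def StarCond (A ε : ℝ) (k : ℕ → ℕ) : Prop :=
  Tendsto (fun n : ℕ =>
    (n : ℝ) ^ 2 / 4 - ε * n + A * Real.sqrt n - (k n : ℝ) * ((n : ℝ) - (k n : ℝ)))
    atTop atBot

/-- The set of permutation matrices inside `GL n F`. -/
def permSet (F : Type) [Field F] (n : ℕ) : Set (GL (Fin n) F) :=
  {M | ∃ σ : Equiv.Perm (Fin n), (M : Matrix (Fin n) (Fin n) F) = σ.permMatrix F}

/-- The set of invertible diagonal matrices inside `GL n F`. -/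
def diagSet (F : Type) [Field F] (n : ℕ) : Set (GL (Fin n) F) :=
  {M | ∃ d : Fin n → F, (M : Matrix (Fin n) (Fin n) F) = Matrix.diagonal d}

/-- The permutation group: subgroup of `GL n F` formed by the permutation matrices. -/
def PermGroup (F : Type) [Field F] (n : ℕ) : Subgroup (GL (Fin n) F) :=
  Subgroup.closure (permSet F n)

/-- The monomial group: subgroup of `GL n F` generated by permutation and diagonal matrices. -/
def MonomialGroup (F : Type) [Field F] (n : ℕ) : Subgroup (GL (Fin n) F) :=
  Subgroup.closure (permSet F n ∪ diagSet F n)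

/-- Number of orbits of a subgroup `G ≤ GL n F` acting on the Grassmannian of
`k`-dimensional subspaces of `F^n` (by taking images of subspaces). -/
noncomputable def numClassesDim {n : ℕ} (F : Type) [Field F]
    (G : Subgroup (GL (Fin n) F)) (k : ℕ) : ℕ :=
  Nat.card (Quot (fun V W : {V : Submodule F (Fin n → F) // Module.finrank F V = k} =>
    ∃ M ∈ G, Submodule.map (Matrix.toLin' (M : Matrix (Fin n) (Fin n) F)) V.1 = W.1))

/-- Number of orbits of a subgroup `G ≤ GL n F` acting on the set of all subspaces of `F^n`. -/
noncomputable def numClasses {n : ℕ} (F : Type) [Field F]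
    (G : Subgroup (GL (Fin n) F)) : ℕ :=
  Nat.card (Quot (fun V W : Submodule F (Fin n → F) =>
    ∃ M ∈ G, Submodule.map (Matrix.toLin' (M : Matrix (Fin n) (Fin n) F)) V = W))

/-- Semilinear orbit relation: `W` is the image of `V` under the semilinear transformation
given by applying the field automorphism `σ` componentwise followed by a monomial matrix. -/
def semiRel (F : Type) [Field F] (n : ℕ) (V W : Submodule F (Fin n → F)) : Prop :=
  ∃ σ : F ≃+* F, ∃ M ∈ MonomialGroup F n,
    (W : Set (Fin n → F)) =
      (fun x => Matrix.mulVec (M : Matrix (Fin n) (Fin n) F) (fun i => σ (x i))) '' (V : Set (Fin n → F))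

/-- Number of semilinear equivalence classes of `k`-dimensional subspaces of `F^n`. -/
noncomputable def numClassesDimSemi (F : Type) [Field F] (n k : ℕ) : ℕ :=
  Nat.card (Quot (fun V W : {V : Submodule F (Fin n → F) // Module.finrank F V = k} =>
    semiRel F n V.1 W.1))

/-- Number of semilinear equivalence classes of subspaces of `F^n`. -/
noncomputable def numClassesSemi (F : Type) [Field F] (n : ℕ) : ℕ :=
  Nat.card (Quot (fun V W : Submodule F (Fin n → F) => semiRel F n V W))

section Counting

variable {F : Type} [Field F] [Fintype F]
variable {E : Type*} [AddCommGroup E] [Module F E]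

lemma finite_submodule [FiniteDimensional F E] : Finite (Submodule F E) := by
  have : Finite E := Module.finite_of_finite F
  infer_instance

/-- The linearly independent `k`-tuples spanning a given subspace `W` are the linearly independent
`k`-tuples of vectors of `W`. -/
def linearIndependentFiberEquiv {k : ℕ} [FiniteDimensional F E]
    (W : {W : Submodule F E // Module.finrank F W = k}) :
    {s : {s : Fin k → E // LinearIndependent F s} //
      (⟨Submodule.span F (Set.range s.1), by
        simpa using finrank_span_eq_card s.2⟩ :
        {W : Submodule F E // Module.finrank F W = k}) = W} ≃
    {t : Fin k → W.1 // LinearIndependent F t} where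
  toFun s := ⟨fun i => ⟨s.1.1 i, by
      have h := congrArg Subtype.val s.2
      simp only at h
      rw [← h]; exact Submodule.subset_span ⟨i, rfl⟩⟩,
    LinearIndependent.of_comp W.1.subtype s.1.2⟩
  invFun t := ⟨⟨fun i => (t.1 i : E), t.2.map' W.1.subtype (Submodule.ker_subtype _)⟩, by
    apply Subtype.ext
    refine Submodule.eq_of_le_of_finrank_eq ?_ ?_
    · rw [Submodule.span_le]
      rintro _ ⟨i, rfl⟩
      exact (t.1 i).2
    · rw [W.2]
      exact (finrank_span_eq_card (t.2.map' W.1.subtype (Submodule.ker_subtype _))).trans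
        (Fintype.card_fin k)⟩
  left_inv s := rfl
  right_inv t := rfl

lemma card_submodule_finrank_mul [FiniteDimensional F E] {k : ℕ}
    (hk : k ≤ Module.finrank F E) :
    Nat.card {W : Submodule F E // Module.finrank F W = k} *
      ∏ i : Fin k, (Fintype.card F ^ k - Fintype.card F ^ i.val) =
      ∏ i : Fin k, (Fintype.card F ^ Module.finrank F E - Fintype.card F ^ i.val) := by
  classical
  have : Finite E := Module.finite_of_finite F
  have : Fintype {W : Submodule F E // Module.finrank F W = k} := Fintype.ofFinite _
  have : Fintype E := Fintype.ofFinite _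
  rw [← card_linearIndependent (K := F) (V := E) hk]
  rw [← Nat.card_congr (Equiv.sigmaFiberEquiv
    (fun s : {s : Fin k → E // LinearIndependent F s} =>
      (⟨Submodule.span F (Set.range s.1), by simpa using finrank_span_eq_card s.2⟩ :
        {W : Submodule F E // Module.finrank F W = k}))), Nat.card_sigma]
  have hcard : ∀ W : {W : Submodule F E // Module.finrank F W = k},
      Nat.card {t : Fin k → W.1 // LinearIndependent F t} =
        ∏ i : Fin k, (Fintype.card F ^ k - Fintype.card F ^ i.val) := by
    intro W
    have : Fintype W.1 := Fintype.ofFinite _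
    have h := card_linearIndependent (K := F) (V := W.1) (k := k) W.2.ge
    rwa [W.2] at h
  rw [Finset.sum_congr rfl (fun W _ =>
    (Nat.card_congr (linearIndependentFiberEquiv W)).trans (hcard W))]
  simp [Nat.card_eq_fintype_card]

lemma card_submodule_finrank [FiniteDimensional F E] {k : ℕ}
    (hk : k ≤ Module.finrank F E) :
    (Nat.card {W : Submodule F E // Module.finrank F W = k} : ℝ) =
      qBinom (Fintype.card F) (Module.finrank F E) k := by
  have hq : 1 < Fintype.card F := Fintype.one_lt_card
  have hq' : (1 : ℝ) < Fintype.card F := by exact_mod_cast hq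
  have h := congrArg (Nat.cast (R := ℝ)) (card_submodule_finrank_mul (F := F) (E := E) hk)
  generalize Module.finrank F E = n at *
  generalize Fintype.card F = q at *
  have key : ∀ m, k ≤ m → ((∏ i : Fin k, (q ^ m - q ^ i.val) : ℕ) : ℝ) =
      (∏ i ∈ Finset.range k, (q : ℝ) ^ i) * ∏ i ∈ Finset.range k, ((q : ℝ) ^ (m - i) - 1) := by
    intro m hm
    rw [Nat.cast_prod, ← Finset.prod_mul_distrib,
      ← Fin.prod_univ_eq_prod_range (fun i => (q : ℝ) ^ i * ((q : ℝ) ^ (m - i) - 1))]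
    refine Finset.prod_congr rfl fun i _ => ?_
    have hi : i.val ≤ m := i.2.le.trans hm
    rw [Nat.cast_sub (Nat.pow_le_pow_right hq.le hi), mul_sub, ← pow_add,
      Nat.add_sub_cancel' hi]
    push_cast
    ring
  have hne : (∏ i ∈ Finset.range k, (q : ℝ) ^ i) ≠ 0 :=
    Finset.prod_ne_zero_iff.2 fun i _ => by positivity
  have hne' : (∏ i ∈ Finset.range k, ((q : ℝ) ^ (k - i) - 1)) ≠ 0 :=
    Finset.prod_ne_zero_iff.2 fun i hi => by
      have := one_lt_pow₀ hq' (Nat.sub_ne_zero_of_lt (Finset.mem_range.1 hi))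
      linarith
  rw [Nat.cast_mul, key k le_rfl, key n hk] at h
  rw [qBinom, Finset.prod_div_distrib, eq_div_iff hne']
  apply mul_left_cancel₀ hne
  linarith

lemma card_submodule [FiniteDimensional F E] :
    (Nat.card (Submodule F E) : ℝ) = Sq (Fintype.card F) (Module.finrank F E) := by
  classical
  have : Finite E := Module.finite_of_finite F
  let f : Submodule F E → Fin (Module.finrank F E + 1) :=
    fun W => ⟨Module.finrank F W, Nat.lt_succ_of_le (Submodule.finrank_le W)⟩
  rw [← Nat.card_congr (Equiv.sigmaFiberEquiv f), Nat.card_sigma, Nat.cast_sum, Sq,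
    ← Fin.sum_univ_eq_sum_range]
  refine Finset.sum_congr rfl fun k _ => ?_
  rw [← card_submodule_finrank (Nat.le_of_lt_succ k.2)]
  congr 1
  exact Nat.card_congr (Equiv.subtypeEquivRight fun W => by simp [f, Fin.ext_iff])

/-- A subspace stable under `N` is determined by its image `I` under `N` and its image in the
subquotient `N⁻¹(I) / I`, whose dimension is that of the kernel of `N`. -/
lemma card_stable_le [FiniteDimensional F E] (N : E →ₗ[F] E) :
    (Nat.card {V : Submodule F E // V.map N ≤ V} : ℝ) ≤
      Sq (Fintype.card F) (Module.finrank F (LinearMap.range N)) *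
        Sq (Fintype.card F) (Module.finrank F (LinearMap.ker N)) := by
  classical
  have : Finite E := Module.finite_of_finite F
  have : Fintype (Submodule F (LinearMap.range N)) := Fintype.ofFinite _
  let f : {V : Submodule F E // V.map N ≤ V} → Submodule F (LinearMap.range N) :=
    fun V => (V.1.map N).comap (LinearMap.range N).subtype
  have hf : ∀ V V', f V = f V' → V.1.map N = V'.1.map N := by
    intro V V' h
    have h2 := congrArg (Submodule.map (LinearMap.range N).subtype) h
    simp only [f, Submodule.map_comap_subtype] at h2
    rwa [inf_eq_right.2 LinearMap.map_le_range, inf_eq_right.2 LinearMap.map_le_range] at h2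
  rw [← Nat.card_congr (Equiv.sigmaFiberEquiv f), Nat.card_sigma, Nat.cast_sum]
  rw [← card_submodule (F := F) (E := LinearMap.range N), Nat.card_eq_fintype_card,
    ← nsmul_eq_mul, Fintype.card]
  refine Finset.sum_le_card_nsmul _ _ _ fun I _ => ?_
  rcases isEmpty_or_nonempty {V // f V = I} with hI | ⟨⟨V₀, hV₀⟩⟩
  · rw [Nat.card_of_isEmpty, Nat.cast_zero, ← card_submodule (F := F) (E := LinearMap.ker N)]
    positivity
  set J := V₀.1.map N with hJ
  set W := J.comap N with hW
  have hJW : J ≤ W := Submodule.map_le_iff_le_comap.1 (Submodule.map_mono V₀.2)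
  set J' := J.comap W.subtype with hJ'
  have hrank : Module.finrank F (W ⧸ J') = Module.finrank F (LinearMap.ker N) := by
    have h1 := Submodule.finrank_quotient_add_finrank J'
    have h2 : Module.finrank F J' = Module.finrank F J :=
      (Submodule.comapSubtypeEquivOfLe hJW).finrank_eq
    have h3 := LinearMap.finrank_range_add_finrank_ker (N.domRestrict W)
    have h4 : LinearMap.range (N.domRestrict W) = J := by
      rw [LinearMap.range_domRestrict, hW, Submodule.map_comap_eq,
        inf_eq_right.2 LinearMap.map_le_range]
    have h5 : Module.finrank F (LinearMap.ker (N.domRestrict W)) =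
        Module.finrank F (LinearMap.ker N) := by
      rw [LinearMap.ker_domRestrict]
      exact (Submodule.comapSubtypeEquivOfLe (by
        intro x hx
        rw [hW, Submodule.mem_comap, LinearMap.mem_ker.1 hx]
        exact zero_mem _)).finrank_eq
    rw [h4, h5] at h3
    omega
  rw [← hrank, ← card_submodule (F := F) (E := W ⧸ J'), Nat.cast_le]
  have hmem : ∀ V : {V // f V = I}, J ≤ V.1.1 ∧ V.1.1 ≤ W := by
    intro V
    have h := hf V.1 V₀ (V.2.trans hV₀.symm)
    exact ⟨hJ ▸ h ▸ V.1.2, Submodule.map_le_iff_le_comap.1 h.le⟩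
  have : Finite (Submodule F (W ⧸ J')) := finite_submodule
  refine Nat.card_le_card_of_injective
    (fun V => (V.1.1.comap W.subtype).map J'.mkQ) fun V V' h => ?_
  have h2 := congrArg (Submodule.comap J'.mkQ) h
  simp only [Submodule.comap_map_mkQ] at h2
  rw [sup_eq_right.2 (Submodule.comap_mono (hmem V).1),
    sup_eq_right.2 (Submodule.comap_mono (hmem V').1)] at h2
  have h3 := congrArg (Submodule.map W.subtype) h2
  simp only [Submodule.map_comap_subtype] at h3
  rw [inf_eq_right.2 (hmem V).2, inf_eq_right.2 (hmem V').2] at h3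
  exact Subtype.ext (Subtype.ext h3)

end Counting

section Bounds

lemma prod_one_sub_inv_pow_ge {x : ℝ} (h0 : 0 ≤ x) (h2 : x ≤ 1 / 2) (k : ℕ) :
    (1 : ℝ) / 4 ≤ ∏ j ∈ Finset.range k, (1 - x ^ (j + 1)) := by
  have half : ∀ k : ℕ, (1 : ℝ) / 4 + (1 / 2) ^ (k + 2) ≤
      ∏ j ∈ Finset.range (k + 1), (1 - (1 / 2 : ℝ) ^ (j + 1)) := by
    intro k
    induction k with
    | zero => norm_num
    | succ k ih =>
      rw [Finset.prod_range_succ]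
      have hy : (0 : ℝ) < (1 / 2) ^ k := by positivity
      have hy1 : (1 / 2 : ℝ) ^ k ≤ 1 := pow_le_one₀ (by norm_num) (by norm_num)
      have hz : (0 : ℝ) ≤ 1 - (1 / 2) ^ (k + 1 + 1) := by
        rw [pow_add, pow_add]; linarith
      refine le_trans ?_ (mul_le_mul_of_nonneg_right ih hz)
      simp only [pow_add]
      nlinarith
  have mono : ∏ j ∈ Finset.range k, (1 - (1 / 2 : ℝ) ^ (j + 1)) ≤
      ∏ j ∈ Finset.range k, (1 - x ^ (j + 1)) := by
    refine Finset.prod_le_prod (fun _ _ => ?_) fun _ _ => ?_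
    · exact sub_nonneg.2 (pow_le_one₀ (by norm_num) (by norm_num))
    · gcongr
  refine le_trans ?_ mono
  cases k with
  | zero => norm_num
  | succ k => exact le_trans (by simp) (half k)

variable {q n k : ℕ}

lemma pow_le_qBinom (hq : 2 ≤ q) (hk : k ≤ n) : (q : ℝ) ^ (k * (n - k)) ≤ qBinom q n k := by
  have hq' : (1 : ℝ) < q := by exact_mod_cast hq
  have hc : (q : ℝ) ^ (k * (n - k)) = ∏ _j ∈ Finset.range k, (q : ℝ) ^ (n - k) := by
    rw [Finset.prod_const, Finset.card_range, ← pow_mul, mul_comm]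
  rw [hc, qBinom]
  refine Finset.prod_le_prod (fun _ _ => by positivity) fun j hj => ?_
  have hj := Finset.mem_range.1 hj
  have h1 := one_lt_pow₀ hq' (Nat.sub_ne_zero_of_lt hj)
  rw [le_div_iff₀ (by linarith), mul_sub, ← pow_add,
    show n - k + (k - j) = n - j by omega, mul_one]
  have : (1 : ℝ) ≤ (q : ℝ) ^ (n - k) := one_le_pow₀ hq'.le
  linarith

lemma qBinom_pos (hq : 2 ≤ q) (hk : k ≤ n) : 0 < qBinom q n k :=
  lt_of_lt_of_le (by positivity) (pow_le_qBinom hq hk)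

lemma qBinom_le (hq : 2 ≤ q) (hk : k ≤ n) : qBinom q n k ≤ 4 * (q : ℝ) ^ (k * (n - k)) := by
  have hq2 : (2 : ℝ) ≤ q := by exact_mod_cast hq
  have hq' : (1 : ℝ) < q := by linarith
  have hP := prod_one_sub_inv_pow_ge (x := (q : ℝ)⁻¹) (by positivity)
    (by rw [one_div]; gcongr) k
  rw [← Finset.prod_range_reflect] at hP
  set P := ∏ j ∈ Finset.range k, (1 - (q : ℝ)⁻¹ ^ (k - 1 - j + 1)) with hPdef
  have hc : (q : ℝ) ^ (k * (n - k)) = ∏ _j ∈ Finset.range k, (q : ℝ) ^ (n - k) := by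
    rw [Finset.prod_const, Finset.card_range, ← pow_mul, mul_comm]
  have hmul : qBinom q n k * P ≤ (q : ℝ) ^ (k * (n - k)) := by
    rw [hc, hPdef, qBinom, ← Finset.prod_mul_distrib]
    have hfac : ∀ j ∈ Finset.range k, 0 < (q : ℝ) ^ (k - j) - 1 := fun j hj => by
      have := one_lt_pow₀ hq' (Nat.sub_ne_zero_of_lt (Finset.mem_range.1 hj))
      linarith
    have heq : ∀ j ∈ Finset.range k, ((q : ℝ) ^ (n - j) - 1) / ((q : ℝ) ^ (k - j) - 1) *
        (1 - (q : ℝ)⁻¹ ^ (k - 1 - j + 1)) = ((q : ℝ) ^ (n - j) - 1) / (q : ℝ) ^ (k - j) := by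
      intro j hj
      have h1 := hfac j hj
      have hj := Finset.mem_range.1 hj
      rw [show k - 1 - j + 1 = k - j by omega, inv_pow]
      have h2 : (q : ℝ) ^ (k - j) ≠ 0 := by positivity
      have h1' := h1.ne'
      field_simp
    refine Finset.prod_le_prod (fun j hj => ?_) fun j hj => ?_
    · rw [heq j hj]
      have : (1 : ℝ) ≤ (q : ℝ) ^ (n - j) := one_le_pow₀ hq'.le
      exact div_nonneg (by linarith) (by positivity)
    · rw [heq j hj, div_le_iff₀ (by positivity), ← pow_add]
      have hj := Finset.mem_range.1 hj
      rw [show n - k + (k - j) = n - j by omega]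
      linarith
  have := qBinom_pos hq hk
  nlinarith

lemma qBinom_le_Sq (hq : 2 ≤ q) (hk : k ≤ n) : qBinom q n k ≤ Sq q n :=
  Finset.single_le_sum (f := fun k => qBinom q n k)
    (fun _ hj => (qBinom_pos hq (Nat.lt_succ_iff.1 (Finset.mem_range.1 hj))).le)
    (Finset.mem_range.2 (Nat.lt_succ_of_le hk))

lemma Sq_pos (hq : 2 ≤ q) : 0 < Sq q n :=
  (qBinom_pos hq (Nat.zero_le n)).trans_le (qBinom_le_Sq hq (Nat.zero_le n))

lemma Sq_le (hq : 2 ≤ q) : Sq q n ≤ 4 * (n + 1) * (q : ℝ) ^ ((n : ℝ) ^ 2 / 4) := by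
  have hq' : (1 : ℝ) ≤ q := by exact_mod_cast (by omega : 1 ≤ q)
  have h : ∀ k ∈ Finset.range (n + 1), qBinom q n k ≤ 4 * (q : ℝ) ^ ((n : ℝ) ^ 2 / 4) := by
    intro k hk
    have hk := Nat.lt_succ_iff.1 (Finset.mem_range.1 hk)
    refine (qBinom_le hq hk).trans ?_
    rw [← Real.rpow_natCast]
    gcongr
    push_cast [hk]
    nlinarith [sq_nonneg ((n : ℝ) - 2 * k)]
  refine (Finset.sum_le_card_nsmul _ _ _ h).trans_eq ?_
  rw [Finset.card_range, nsmul_eq_mul]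
  push_cast
  ring

end Bounds

section Generators

open Polynomial

variable {F : Type} [Field F] [Fintype F]
variable {E : Type*} [AddCommGroup E] [Module F E]

/-- If `E` is generated by `ι`-many vectors as an `F[X]`-module, with `X` acting as `T`, then every
`T`-stable subspace is too. -/
lemma card_stable_le_pow [FiniteDimensional F E] {ι : Type} [Fintype ι] (T : E →ₗ[F] E)
    (v : ι → E) (hv : ∀ V : Submodule F E, V.map T ≤ V → (∀ i, v i ∈ V) → V = ⊤) :
    Nat.card {V : Submodule F E // V.map T ≤ V} ≤
      Fintype.card F ^ (Module.finrank F E * Fintype.card ι) := by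
  classical
  have hE : Finite E := Module.finite_of_finite F
  have : Fintype E := Fintype.ofFinite _
  let o := Module.AEval'.of T
  let π : (ι → F[X]) →ₗ[F[X]] Module.AEval' T :=
    Fintype.linearCombination F[X] (fun i => o (v i))
  have hstable : ∀ P : Submodule F[X] (Module.AEval' T),
      ((P.restrictScalars F).comap o.toLinearMap).map T ≤
        (P.restrictScalars F).comap o.toLinearMap := by
    rintro P _ ⟨x, hx, rfl⟩
    change o (T x) ∈ P
    rw [← Module.AEval'.X_smul_of]
    exact P.smul_mem _ hx
  have hπ : LinearMap.range π = ⊤ := by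
    have h := hv _ (hstable (LinearMap.range π)) fun i =>
      ⟨Pi.single i 1, by simp [π, o]⟩
    refine eq_top_iff.2 fun y _ => ?_
    have hy : o.symm y ∈ (⊤ : Submodule F E) := trivial
    rw [← h] at hy
    have hy' : o (o.symm y) ∈ LinearMap.range π := hy
    rwa [o.apply_symm_apply] at hy'
  let g : (ι → E) → Submodule F E := fun w =>
    ((Submodule.span F[X] (Set.range fun i => o (w i))).restrictScalars F).comap o.toLinearMap
  have hg : ∀ V : {V : Submodule F E // V.map T ≤ V}, ∃ w, g w = V.1 := by
    rintro ⟨V, hV⟩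
    let V' : Submodule F[X] (Module.AEval' T) := Module.AEval.mapSubmodule F E T
      ⟨V, Submodule.map_le_iff_le_comap.1 hV⟩
    have hmem : ∀ x, o x ∈ V' ↔ x ∈ V := by
      intro x
      simp only [V', Module.AEval.mem_mapSubmodule_apply]
      exact Iff.rfl
    let L := V'.comap π
    obtain ⟨m, ⟨b⟩⟩ := Submodule.nonempty_basis_of_pid (Pi.basisFun F[X] ι) L
    have hm : m ≤ Fintype.card ι := by
      have h := Submodule.finrank_le L
      rwa [Module.finrank_eq_card_basis b, Module.finrank_fintype_fun_eq_card,
        Fintype.card_fin] at h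
    obtain ⟨e⟩ : Nonempty (Fin m ↪ ι) := Function.Embedding.nonempty_of_card_le (by simpa)
    let w : ι → E := Function.extend e (fun j => o.symm (π (b j))) 0
    have hw : ∀ j, o (w (e j)) = π (b j) := by
      intro j
      simp only [w, e.injective.extend_apply, o.apply_symm_apply]
    have hspan : Submodule.span F[X] (Set.range fun i => o (w i)) = V' := by
      apply le_antisymm
      · rw [Submodule.span_le]
        rintro _ ⟨i, rfl⟩
        by_cases hi : ∃ j, e j = i
        · obtain ⟨j, rfl⟩ := hi
          change o (w (e j)) ∈ V'
          rw [hw]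
          exact (b j).2
        · simp [w, Function.extend_apply' _ _ _ hi]
      · have hL : L.map π = V' := by
          rw [Submodule.map_comap_eq, hπ, top_inf_eq]
        have hb : L = Submodule.span F[X] (Set.range fun j => (b j : ι → F[X])) := by
          have h := congrArg (Submodule.map L.subtype) b.span_eq
          rw [Submodule.map_span, Submodule.map_subtype_top, ← Set.range_comp] at h
          exact h.symm
        rw [← hL, hb, Submodule.map_span, Submodule.span_le]
        rintro _ ⟨_, ⟨j, rfl⟩, rfl⟩
        rw [← hw]
        exact Submodule.subset_span ⟨e j, rfl⟩
    refine ⟨w, ?_⟩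
    ext x
    simp only [g, hspan]
    exact hmem x
  choose w hw using hg
  have hcard := Nat.card_le_card_of_injective w fun V V' h =>
    Subtype.ext (by rw [← hw V, ← hw V', h])
  refine hcard.trans_eq ?_
  rw [Nat.card_eq_fintype_card, Fintype.card_fun, Module.card_eq_pow_finrank (K := F) (V := E),
    pow_mul]

end Generators

section Permutations

variable (F : Type) [Field F] {n : ℕ}

/-- The number of orbits of a permutation, including fixed points. -/
noncomputable def orbitCount (σ : Equiv.Perm (Fin n)) : ℕ :=
  Nat.card (Quotient (Equiv.Perm.SameCycle.setoid σ))

lemma two_mul_orbitCount_le (σ : Equiv.Perm (Fin n)) :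
    2 * orbitCount σ + σ.support.card ≤ 2 * n := by
  classical
  let Q := Quotient (Equiv.Perm.SameCycle.setoid σ)
  have : Fintype Q := Fintype.ofFinite _
  let f : Q ⊕ Q → Fin n ⊕ {i // i ∉ σ.support} := fun x => match x with
    | .inl a => .inl a.out
    | .inr a => if h : σ a.out = a.out then .inr ⟨a.out, by simpa using h⟩ else .inl (σ a.out)
  have hout : ∀ a b : Q, σ a.out = b.out → a = b := by
    intro a b h
    rw [← a.out_eq, ← b.out_eq]
    exact Quotient.sound (show σ.SameCycle a.out b.out from ⟨1, by simpa using h⟩)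
  have hf : Function.Injective f := by
    rintro (a | a) (b | b) h
    · simpa [f] using h
    · simp only [f] at h
      split_ifs at h with hb
      have h' := Sum.inl_injective h
      have := hout b a h'.symm
      subst this
      exact absurd h'.symm hb
    · simp only [f] at h
      split_ifs at h with ha
      have h' := Sum.inl_injective h
      have := hout a b h'
      subst this
      exact absurd h' ha
    · simp only [f] at h
      split_ifs at h with ha hb hb
      · have h' := congrArg Subtype.val (Sum.inr_injective h)
        rw [Quotient.out_injective h']
      · have h' := σ.injective (Sum.inl_injective h)
        rw [Quotient.out_injective h']
  have hcard := Fintype.card_le_of_injective f hf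
  rw [Fintype.card_sum, Fintype.card_sum, Fintype.card_fin, Fintype.card_subtype_compl,
    Fintype.card_fin, Fintype.card_coe] at hcard
  have hs : σ.support.card ≤ n := by simpa using Finset.card_le_univ σ.support
  rw [orbitCount, Nat.card_eq_fintype_card]
  change 2 * Fintype.card Q + _ ≤ _
  omega

/-- The vectors fixed by a permutation are the functions on its set of orbits. -/
noncomputable def kerFunLeftSubOneEquiv (σ : Equiv.Perm (Fin n)) :
    LinearMap.ker (LinearMap.funLeft F F σ - 1) ≃ₗ[F]
      (Quotient (Equiv.Perm.SameCycle.setoid σ) → F) where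
  toFun x a := x.1 a.out
  map_add' _ _ := rfl
  map_smul' _ _ := rfl
  invFun y := ⟨fun i => y (Quotient.mk _ i), by
    rw [LinearMap.mem_ker, LinearMap.sub_apply, sub_eq_zero]
    funext i
    rw [LinearMap.funLeft_apply]
    exact congrArg y (Quotient.sound (show σ.SameCycle (σ i) i from ⟨-1, by simp⟩))⟩
  left_inv x := by
    apply Subtype.ext
    funext i
    have hx : ∀ j, x.1 (σ j) = x.1 j := fun j => by
      have h := x.2
      rw [LinearMap.mem_ker, LinearMap.sub_apply, sub_eq_zero] at h
      exact congrFun h j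
    have hpow : ∀ (m : ℕ) j, x.1 ((σ ^ m) j) = x.1 j := by
      intro m
      induction m with
      | zero => simp
      | succ m ih => intro j; rw [pow_succ, Equiv.Perm.mul_apply, ih, hx]
    have hsame : σ.SameCycle (Quotient.mk (Equiv.Perm.SameCycle.setoid σ) i).out i :=
      Quotient.mk_out (s := Equiv.Perm.SameCycle.setoid σ) i
    obtain ⟨m, -, hm⟩ := hsame.exists_pow_eq'
    change x.1 _ = x.1 i
    rw [← hm, hpow, hm]
  right_inv y := by
    funext a
    change y (Quotient.mk _ a.out) = y a
    rw [Quotient.out_eq]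

lemma finrank_ker_funLeft_sub_one (σ : Equiv.Perm (Fin n)) :
    Module.finrank F (LinearMap.ker (LinearMap.funLeft F F σ - 1)) = orbitCount σ := by
  have : Fintype (Quotient (Equiv.Perm.SameCycle.setoid σ)) := Fintype.ofFinite _
  rw [(kerFunLeftSubOneEquiv F σ).finrank_eq, Module.finrank_fintype_fun_eq_card, orbitCount,
    Nat.card_eq_fintype_card]

/-- The number of subspaces stable under a permutation of the coordinates. -/
noncomputable def stableCount (σ : Equiv.Perm (Fin n)) : ℕ :=
  Nat.card {V : Submodule F (Fin n → F) // V.map (LinearMap.funLeft F F σ) ≤ V}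

lemma map_sub_one_le_iff {E : Type*} [AddCommGroup E] [Module F E] (T : E →ₗ[F] E)
    (V : Submodule F E) : V.map (T - 1) ≤ V ↔ V.map T ≤ V := by
  simp only [Submodule.map_le_iff_le_comap]
  refine forall₂_congr fun x hx => ?_
  simp [V.sub_mem_iff_left hx]

variable [Fintype F]

lemma stableCount_le_Sq_mul_Sq (σ : Equiv.Perm (Fin n)) :
    (stableCount F σ : ℝ) ≤
      Sq (Fintype.card F) (n - orbitCount σ) * Sq (Fintype.card F) (orbitCount σ) := by
  have h := card_stable_le (LinearMap.funLeft F F σ - 1)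
  have hr := LinearMap.finrank_range_add_finrank_ker (LinearMap.funLeft F F σ - 1)
  rw [finrank_ker_funLeft_sub_one] at hr h
  rw [Module.finrank_fintype_fun_eq_card, Fintype.card_fin] at hr
  rw [Nat.sub_eq_of_eq_add hr.symm]
  refine le_trans (le_of_eq ?_) h
  rw [stableCount]
  congr 1
  exact Nat.card_congr (Equiv.subtypeEquivRight fun V => (map_sub_one_le_iff F _ V).symm)

lemma stableCount_le_pow (σ : Equiv.Perm (Fin n)) :
    stableCount F σ ≤ Fintype.card F ^ (n * orbitCount σ) := by
  classical
  have : Fintype (Quotient (Equiv.Perm.SameCycle.setoid σ)) := Fintype.ofFinite _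
  have h := card_stable_le_pow (LinearMap.funLeft F F σ)
    (fun a : Quotient (Equiv.Perm.SameCycle.setoid σ) => (Pi.single a.out 1 : Fin n → F)) ?_
  · rwa [Module.finrank_fintype_fun_eq_card, Fintype.card_fin, ← Nat.card_eq_fintype_card
      (α := Quotient (Equiv.Perm.SameCycle.setoid σ))] at h
  intro V hV hmem
  have hstep : ∀ i, (Pi.single (σ i) 1 : Fin n → F) ∈ V → (Pi.single i 1 : Fin n → F) ∈ V := by
    intro i hi
    convert hV (Submodule.mem_map_of_mem hi) using 1
    funext j
    simp [LinearMap.funLeft_apply, Pi.single_apply]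
  have hpow : ∀ (m : ℕ) i, (Pi.single ((σ ^ m) i) 1 : Fin n → F) ∈ V →
      (Pi.single i 1 : Fin n → F) ∈ V := by
    intro m
    induction m with
    | zero => simp
    | succ m ih =>
      intro i hi
      rw [pow_succ, Equiv.Perm.mul_apply] at hi
      exact hstep _ (ih _ hi)
  rw [eq_top_iff, ← (Pi.basisFun F (Fin n)).span_eq, Submodule.span_le]
  rintro _ ⟨i, rfl⟩
  rw [Pi.basisFun_apply]
  have hsame : σ.SameCycle i (Quotient.mk (Equiv.Perm.SameCycle.setoid σ) i).out :=
    (Quotient.mk_out (s := Equiv.Perm.SameCycle.setoid σ) i).symm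
  obtain ⟨m, -, hm⟩ := hsame.exists_pow_eq'
  refine hpow m i ?_
  rw [hm]
  exact hmem _

lemma stableCount_le (σ : Equiv.Perm (Fin n)) :
    (stableCount F σ : ℝ) ≤ 16 * (n + 1) ^ 2 *
      (Fintype.card F : ℝ) ^ ((n : ℝ) ^ 2 / 4 - n * σ.support.card / 20) := by
  have hq : 2 ≤ Fintype.card F := Fintype.one_lt_card
  have h2 := two_mul_orbitCount_le σ
  have hs : σ.support.card ≤ n := by simpa using Finset.card_le_univ σ.support
  have hA := stableCount_le_Sq_mul_Sq F σ
  have hB := stableCount_le_pow F σ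
  generalize stableCount F σ = N at *
  generalize orbitCount σ = c at *
  generalize σ.support.card = s at *
  generalize Fintype.card F = q at *
  have hq1 : (1 : ℝ) ≤ q := by exact_mod_cast (by omega : 1 ≤ q)
  have hq0 : (0 : ℝ) < q := by linarith
  obtain ⟨r, rfl⟩ : ∃ r, n = r + c := ⟨n - c, by omega⟩
  have h2' : (s : ℝ) ≤ 2 * r := by exact_mod_cast (by omega : s ≤ 2 * r)
  have hs' : (s : ℝ) ≤ r + c := by exact_mod_cast hs
  have hr0 : (0 : ℝ) ≤ r := by positivity
  have hc0 : (0 : ℝ) ≤ c := by positivity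
  push_cast
  rcases le_or_gt (r + c) (5 * c) with hc | hc
  · have hc' : (r : ℝ) + c ≤ 5 * c := by exact_mod_cast hc
    rw [Nat.add_sub_cancel] at hA
    refine hA.trans ((mul_le_mul (Sq_le hq) (Sq_le hq) (Sq_pos hq).le (by positivity)).trans ?_)
    have hexp : (r : ℝ) ^ 2 / 4 + (c : ℝ) ^ 2 / 4 ≤
        ((r : ℝ) + c) ^ 2 / 4 - (r + c) * s / 20 := by nlinarith
    calc 4 * ((r : ℝ) + 1) * (q : ℝ) ^ ((r : ℝ) ^ 2 / 4) *
          (4 * ((c : ℝ) + 1) * (q : ℝ) ^ ((c : ℝ) ^ 2 / 4))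
        = 16 * (((r : ℝ) + 1) * (c + 1)) * (q : ℝ) ^ ((r : ℝ) ^ 2 / 4 + (c : ℝ) ^ 2 / 4) := by
          rw [Real.rpow_add hq0]; ring
      _ ≤ _ := by
          gcongr
          nlinarith
  · have hc' : 5 * (c : ℝ) < r + c := by exact_mod_cast hc
    have hB' : (N : ℝ) ≤ (q : ℝ) ^ (((r : ℝ) + c) * c) := by
      have : (N : ℝ) ≤ (q : ℝ) ^ ((r + c) * c) := by exact_mod_cast hB
      rw [← Real.rpow_natCast] at this
      push_cast at this
      exact this
    refine hB'.trans ?_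
    rw [← one_mul ((q : ℝ) ^ (((r : ℝ) + c) * c))]
    gcongr
    · nlinarith
    · nlinarith

end Permutations

section Orbits

variable (F : Type) [Field F] {n : ℕ}

lemma toLin'_permMatrix (σ : Equiv.Perm (Fin n)) :
    Matrix.toLin' (σ.permMatrix F) = LinearMap.funLeft F F σ := by
  refine LinearMap.ext fun x => ?_
  rw [Matrix.toLin'_apply, Matrix.permMatrix_mulVec]
  rfl

lemma exists_eq_permMatrix_of_mem {M : GL (Fin n) F} (hM : M ∈ PermGroup F n) :
    ∃ σ : Equiv.Perm (Fin n), (M : Matrix (Fin n) (Fin n) F) = σ.permMatrix F := by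
  induction hM using Subgroup.closure_induction with
  | mem M h => exact h
  | one => exact ⟨1, by simp⟩
  | mul M N _ _ hM hN =>
    obtain ⟨σ, hσ⟩ := hM
    obtain ⟨τ, hτ⟩ := hN
    exact ⟨τ * σ, by rw [Matrix.permMatrix_mul, Units.val_mul, hσ, hτ]⟩
  | inv M _ hM =>
    obtain ⟨σ, hσ⟩ := hM
    refine ⟨σ⁻¹, ?_⟩
    have h : (M : Matrix (Fin n) (Fin n) F) * (σ⁻¹).permMatrix F = 1 := by
      rw [hσ, ← Matrix.permMatrix_mul]; simp
    calc ((M⁻¹ : GL (Fin n) F) : Matrix (Fin n) (Fin n) F)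
        = (M⁻¹ : GL (Fin n) F) * (M * (σ⁻¹).permMatrix F) := by rw [h, mul_one]
      _ = _ := by rw [← mul_assoc, Units.inv_mul, one_mul]

lemma exists_mem_PermGroup_iff (p : (Matrix (Fin n) (Fin n) F) → Prop) :
    (∃ M ∈ PermGroup F n, p (M : Matrix (Fin n) (Fin n) F)) ↔
      ∃ σ : Equiv.Perm (Fin n), p (σ⁻¹.permMatrix F) := by
  constructor
  · rintro ⟨M, hM, h⟩
    obtain ⟨σ, hσ⟩ := exists_eq_permMatrix_of_mem F hM
    exact ⟨σ⁻¹, by rwa [inv_inv, ← hσ]⟩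
  · rintro ⟨σ, h⟩
    refine ⟨⟨σ⁻¹.permMatrix F, σ.permMatrix F, ?_, ?_⟩,
      Subgroup.subset_closure ⟨σ⁻¹, rfl⟩, h⟩ <;>
    · rw [← Matrix.permMatrix_mul]; simp

lemma funLeft_inv_mul (σ τ : Equiv.Perm (Fin n)) :
    LinearMap.funLeft F F ⇑(σ * τ)⁻¹ =
      LinearMap.funLeft F F ⇑σ⁻¹ ∘ₗ LinearMap.funLeft F F ⇑τ⁻¹ := by
  rw [_root_.mul_inv_rev]; rfl

/-- The action of permutations of the coordinates on subspaces. -/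
@[reducible] def permAction : MulAction (Equiv.Perm (Fin n)) (Submodule F (Fin n → F)) where
  smul σ V := V.map (LinearMap.funLeft F F ⇑σ⁻¹)
  one_smul V := by
    change V.map (LinearMap.funLeft F F ⇑(1 : Equiv.Perm (Fin n))⁻¹) = V
    rw [inv_one]
    exact Submodule.map_id V
  mul_smul σ τ V := by
    change V.map (LinearMap.funLeft F F ⇑(σ * τ)⁻¹) = (V.map _).map _
    rw [funLeft_inv_mul, Submodule.map_comp]

/-- The action of permutations of the coordinates on `k`-dimensional subspaces. -/
@[reducible] def permActionDim (k : ℕ) : MulAction (Equiv.Perm (Fin n))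
    {V : Submodule F (Fin n → F) // Module.finrank F V = k} where
  smul σ V := ⟨V.1.map (LinearMap.funLeft F F ⇑σ⁻¹),
    (Submodule.equivMapOfInjective _
      (LinearMap.funLeft_injective_of_surjective F F _ σ⁻¹.surjective) V.1).finrank_eq.symm.trans
      V.2⟩
  one_smul V := Subtype.ext ((permAction F).one_smul V.1)
  mul_smul σ τ V := Subtype.ext ((permAction F).mul_smul σ τ V.1)

/-- Burnside's lemma with the contribution of the identity separated. -/
lemma card_quot_mul_factorial_bounds {X : Type*} [Finite X] [MulAction (Equiv.Perm (Fin n)) X]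
    (r : X → X → Prop) (hr : ∀ x y, r x y ↔ ∃ σ : Equiv.Perm (Fin n), σ • x = y)
    (B : Equiv.Perm (Fin n) → ℝ)
    (hB : ∀ σ, (Nat.card (MulAction.fixedBy X σ) : ℝ) ≤ B σ) :
    (Nat.card X : ℝ) ≤ Nat.card (Quot r) * n.factorial ∧
      (Nat.card (Quot r) * n.factorial : ℝ) ≤
        Nat.card X + ∑ σ ∈ Finset.univ.erase (1 : Equiv.Perm (Fin n)), B σ := by
  classical
  have := Fintype.ofFinite X
  have : Fintype (MulAction.orbitRel.Quotient (Equiv.Perm (Fin n)) X) := Fintype.ofFinite _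
  have hquot : Nat.card (Quot r) =
      Fintype.card (MulAction.orbitRel.Quotient (Equiv.Perm (Fin n)) X) := by
    rw [← Nat.card_eq_fintype_card]
    refine Nat.card_congr (Quot.congr (Equiv.refl X) fun x y => ?_)
    rw [hr]
    constructor
    · rintro ⟨σ, rfl⟩
      exact (MulAction.orbitRel _ X).symm ⟨σ, rfl⟩
    · intro h
      obtain ⟨σ, h⟩ := (MulAction.orbitRel (Equiv.Perm (Fin n)) X).symm h
      exact ⟨σ, h⟩
  have hburn : (∑ σ : Equiv.Perm (Fin n), (Nat.card (MulAction.fixedBy X σ) : ℝ)) =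
      Nat.card (Quot r) * n.factorial := by
    have h := MulAction.sum_card_fixedBy_eq_card_orbits_mul_card_group
      (Equiv.Perm (Fin n)) X
    rw [← hquot, Fintype.card_perm, Fintype.card_fin] at h
    rw [← Nat.cast_mul, ← h, Nat.cast_sum]
    exact Finset.sum_congr rfl fun σ _ => by rw [Nat.card_eq_fintype_card]
  have hone : Nat.card (MulAction.fixedBy X (1 : Equiv.Perm (Fin n))) = Nat.card X :=
    Nat.card_congr ((Equiv.setCongr (by ext; simp)).trans (Equiv.Set.univ X))
  rw [← hburn, ← Finset.add_sum_erase _ _ (Finset.mem_univ 1), hone]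
  refine ⟨le_add_of_nonneg_right (by positivity), ?_⟩
  gcongr with σ
  exact hB σ

variable [Fintype F]

/-- The bound on the number of subspaces stable under a permutation. -/
noncomputable def stableBound (q : ℕ) (σ : Equiv.Perm (Fin n)) : ℝ :=
  16 * (n + 1) ^ 2 * (q : ℝ) ^ ((n : ℝ) ^ 2 / 4 - n * σ.support.card / 20)

lemma stableCount_inv_le (σ : Equiv.Perm (Fin n)) :
    (stableCount F σ⁻¹ : ℝ) ≤ stableBound (Fintype.card F) σ := by
  simpa [stableBound] using stableCount_le F σ⁻¹

lemma numClasses_bounds (n : ℕ) :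
    Sq (Fintype.card F) n ≤ numClasses F (PermGroup F n) * n.factorial ∧
      (numClasses F (PermGroup F n) * n.factorial : ℝ) ≤ Sq (Fintype.card F) n +
        ∑ σ ∈ Finset.univ.erase (1 : Equiv.Perm (Fin n)), stableBound (Fintype.card F) σ := by
  let := permAction F (n := n)
  have : Finite (Submodule F (Fin n → F)) := finite_submodule
  have h := card_quot_mul_factorial_bounds
    (fun V W : Submodule F (Fin n → F) =>
      ∃ M ∈ PermGroup F n, Submodule.map (Matrix.toLin' (M : Matrix (Fin n) (Fin n) F)) V = W)
    (fun V W => by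
      rw [exists_mem_PermGroup_iff F (fun M => Submodule.map (Matrix.toLin' M) V = W)]
      simp only [toLin'_permMatrix]
      exact Iff.rfl)
    (stableBound (Fintype.card F)) (fun σ => ?_)
  · rw [card_submodule, Module.finrank_fintype_fun_eq_card, Fintype.card_fin] at h
    exact h
  · refine le_trans ?_ (stableCount_inv_le F σ)
    rw [Nat.cast_le]
    exact Nat.card_le_card_of_injective (fun V => ⟨V.1, le_of_eq V.2⟩)
      fun V W h => Subtype.ext (congrArg (fun x => x.1) h)

lemma numClassesDim_bounds {n k : ℕ} (hk : k ≤ n) :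
    qBinom (Fintype.card F) n k ≤ numClassesDim F (PermGroup F n) k * n.factorial ∧
      (numClassesDim F (PermGroup F n) k * n.factorial : ℝ) ≤ qBinom (Fintype.card F) n k +
        ∑ σ ∈ Finset.univ.erase (1 : Equiv.Perm (Fin n)), stableBound (Fintype.card F) σ := by
  let := permActionDim F (n := n) k
  have : Finite (Submodule F (Fin n → F)) := finite_submodule
  have h := card_quot_mul_factorial_bounds
    (fun V W : {V : Submodule F (Fin n → F) // Module.finrank F V = k} =>
      ∃ M ∈ PermGroup F n, Submodule.map (Matrix.toLin' (M : Matrix (Fin n) (Fin n) F)) V.1 = W.1)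
    (fun V W => by
      rw [exists_mem_PermGroup_iff F (fun M => Submodule.map (Matrix.toLin' M) V.1 = W.1)]
      simp only [toLin'_permMatrix]
      exact exists_congr fun σ => ⟨fun h => Subtype.ext h, fun h => congrArg Subtype.val h⟩)
    (stableBound (Fintype.card F)) (fun σ => ?_)
  · rw [card_submodule_finrank (by simpa using hk), Module.finrank_fintype_fun_eq_card,
      Fintype.card_fin] at h
    exact h
  · refine le_trans ?_ (stableCount_inv_le F σ)
    rw [Nat.cast_le]
    exact Nat.card_le_card_of_injective
      (fun V => ⟨V.1.1, le_of_eq (congrArg Subtype.val V.2)⟩)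
      fun V W h => Subtype.ext (Subtype.ext (congrArg (fun x => x.1) h))

end Orbits

section Asymptotics

lemma sum_pow_card_support_le {n : ℕ} {x : ℝ} (hx : 0 ≤ x) :
    ∑ σ : Equiv.Perm (Fin n), x ^ σ.support.card ≤ (1 + n * x) ^ n := by
  have hprod : ∀ σ : Equiv.Perm (Fin n),
      x ^ σ.support.card = ∏ i, if σ i = i then 1 else x := by
    intro σ
    rw [← Finset.prod_filter_mul_prod_filter_not Finset.univ (fun i => σ i = i)]
    rw [Finset.prod_congr rfl (g := fun _ => (1 : ℝ)) (by simp +contextual),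
      Finset.prod_congr rfl (g := fun _ => x)
        (s₁ := Finset.univ.filter fun i => ¬ σ i = i) (by simp +contextual)]
    rw [Finset.prod_const_one, one_mul, Finset.prod_const]
    rfl
  have hsum : ∀ i : Fin n, ∑ j, (if j = i then 1 else x) ≤ 1 + n * x := by
    intro i
    calc ∑ j, (if j = i then 1 else x) ≤ ∑ j : Fin n, ((if j = i then 1 else 0) + x) := by
          gcongr with j
          split_ifs <;> linarith
      _ = 1 + n * x := by simp [Finset.sum_add_distrib]
  have hnonneg : ∀ i j : Fin n, 0 ≤ if j = i then 1 else x := by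
    intro i j; split_ifs <;> linarith
  calc ∑ σ : Equiv.Perm (Fin n), x ^ σ.support.card
      = ∑ σ : Equiv.Perm (Fin n), ∏ i, if σ i = i then 1 else x :=
        Finset.sum_congr rfl fun σ _ => hprod σ
    _ = ∑ f ∈ Finset.univ.map ⟨fun σ : Equiv.Perm (Fin n) => (σ : Fin n → Fin n),
          DFunLike.coe_injective⟩, ∏ i, if f i = i then 1 else x := by
        rw [Finset.sum_map]; rfl
    _ ≤ ∑ f : Fin n → Fin n, ∏ i, if f i = i then 1 else x :=
        Finset.sum_le_sum_of_subset_of_nonneg (Finset.subset_univ _)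
          fun f _ _ => Finset.prod_nonneg fun i _ => hnonneg i (f i)
    _ = ∏ i : Fin n, ∑ j, if j = i then 1 else x := by
        rw [Finset.prod_univ_sum, Fintype.piFinset_univ]
    _ ≤ ∏ _i : Fin n, (1 + n * x) :=
        Finset.prod_le_prod (fun i _ => Finset.sum_nonneg fun j _ => hnonneg i j)
          fun i _ => hsum i
    _ = (1 + n * x) ^ n := by simp

lemma sum_erase_one_stableBound_le {q : ℕ} (hq : 2 ≤ q) (n : ℕ) :
    ∑ σ ∈ Finset.univ.erase (1 : Equiv.Perm (Fin n)), stableBound q σ ≤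
      (q : ℝ) ^ ((n : ℝ) ^ 2 / 4 - n / 40) *
        (16 * (n + 1) ^ 2 * ((1 + n * ((q : ℝ) ^ (-(1 / 40) : ℝ)) ^ n) ^ n - 1)) := by
  have hq1 : (1 : ℝ) ≤ q := by exact_mod_cast (by omega : 1 ≤ q)
  have hq0 : (0 : ℝ) < q := by linarith
  set y := ((q : ℝ) ^ (-(1 / 40) : ℝ)) ^ n with hy
  have hy0 : 0 ≤ y := by positivity
  have hterm : ∀ σ ∈ Finset.univ.erase (1 : Equiv.Perm (Fin n)), stableBound q σ ≤
      (q : ℝ) ^ ((n : ℝ) ^ 2 / 4 - n / 40) * (16 * (n + 1) ^ 2) * y ^ σ.support.card := by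
    intro σ hσ
    have hs : 1 ≤ σ.support.card := Finset.card_pos.2
      (Finset.nonempty_iff_ne_empty.2 fun h =>
        (Finset.mem_erase.1 hσ).1 (Equiv.Perm.support_eq_empty_iff.1 h))
    have hs' : (1 : ℝ) ≤ σ.support.card := by exact_mod_cast hs
    have hys : y ^ σ.support.card = (q : ℝ) ^ (-(n * σ.support.card / 40) : ℝ) := by
      rw [hy, ← Real.rpow_natCast, ← Real.rpow_natCast, ← Real.rpow_mul hq0.le,
        ← Real.rpow_mul hq0.le]
      congr 1
      ring
    rw [hys, stableBound, mul_comm ((q : ℝ) ^ _) (16 * _), mul_assoc _ ((q : ℝ) ^ _),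
      ← Real.rpow_add hq0]
    have hn : (0 : ℝ) ≤ n := by positivity
    gcongr
    nlinarith
  refine (Finset.sum_le_sum hterm).trans ?_
  rw [← Finset.mul_sum, mul_assoc]
  have h := sum_pow_card_support_le (n := n) hy0
  rw [← Finset.add_sum_erase _ _ (Finset.mem_univ (1 : Equiv.Perm (Fin n)))] at h
  simp only [Equiv.Perm.support_one, Finset.card_empty, pow_zero] at h
  refine mul_le_mul_of_nonneg_left (mul_le_mul_of_nonneg_left ?_ (by positivity)) (by positivity)
  linarith

lemma tendsto_pow_mul_one_add_pow_sub_one {c : ℝ} (h0 : 0 ≤ c) (h1 : c < 1) :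
    Tendsto (fun n : ℕ => 16 * ((n : ℝ) + 1) ^ 2 * ((1 + n * c ^ n) ^ n - 1)) atTop (𝓝 0) := by
  have habs : |c| < 1 := by rwa [abs_of_nonneg h0]
  have hA : Tendsto (fun n : ℕ => (n : ℝ) ^ 4 * c ^ n) atTop (𝓝 0) :=
    tendsto_pow_const_mul_const_pow_of_abs_lt_one 4 habs
  have hB : Tendsto (fun n : ℕ => (n : ℝ) ^ 2 * c ^ n) atTop (𝓝 0) :=
    tendsto_pow_const_mul_const_pow_of_abs_lt_one 2 habs
  have hC : Tendsto (fun n : ℕ => 128 * ((n : ℝ) ^ 4 * c ^ n)) atTop (𝓝 0) := by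
    simpa using hA.const_mul 128
  refine squeeze_zero' (Eventually.of_forall fun n => ?_) ?_ hC
  · have : (1 : ℝ) ≤ (1 + n * c ^ n) ^ n := one_le_pow₀ (le_add_of_nonneg_right (by positivity))
    exact mul_nonneg (by positivity) (by linarith)
  · filter_upwards [hB.eventually_le_const one_pos, eventually_ge_atTop 1] with n hn hn1
    have hn1' : (1 : ℝ) ≤ n := by exact_mod_cast hn1
    have ht0 : 0 ≤ (n : ℝ) ^ 2 * c ^ n := by positivity
    have hexp : (1 + n * c ^ n) ^ n ≤ Real.exp ((n : ℝ) ^ 2 * c ^ n) := by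
      rw [show (n : ℝ) ^ 2 * c ^ n = n * (n * c ^ n) by ring, Real.exp_nat_mul]
      gcongr
      linarith [Real.add_one_le_exp (n * c ^ n)]
    have hle : Real.exp ((n : ℝ) ^ 2 * c ^ n) - 1 ≤ 2 * ((n : ℝ) ^ 2 * c ^ n) := by
      have h := Real.abs_exp_sub_one_le (x := (n : ℝ) ^ 2 * c ^ n) (by rwa [abs_of_nonneg ht0])
      rw [abs_of_nonneg ht0] at h
      exact (le_abs_self _).trans h
    calc 16 * ((n : ℝ) + 1) ^ 2 * ((1 + n * c ^ n) ^ n - 1)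
        ≤ 16 * (n + n) ^ 2 * (2 * ((n : ℝ) ^ 2 * c ^ n)) := by
          have h0' : (0 : ℝ) ≤ 2 * ((n : ℝ) ^ 2 * c ^ n) := by positivity
          have h1' : (1 + n * c ^ n) ^ n - 1 ≤ 2 * ((n : ℝ) ^ 2 * c ^ n) := by linarith
          refine (mul_le_mul_of_nonneg_left h1' (by positivity)).trans ?_
          gcongr
      _ = 128 * ((n : ℝ) ^ 4 * c ^ n) := by ring

lemma div_div_div_eq_of_mul {a b S N f : ℝ} (hb : b ≠ 0) (hS : S ≠ 0) (hf : f ≠ 0) :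
    a / N / (b / S) = (a * f / b) / (N * f / S) := by
  by_cases hN : N = 0
  · simp [hN]
  field_simp

/-- A quantity exceeding `b` by at most `m * e` is asymptotic to `b` when `m ≤ b` and `e → 0`. -/
lemma tendsto_div_one_of_bounds {a b m e : ℕ → ℝ} (hb : ∀ n, 0 < b n)
    (hm : ∀ᶠ n in atTop, m n ≤ b n) (he : Tendsto e atTop (𝓝 0)) (he0 : ∀ n, 0 ≤ e n)
    (hl : ∀ n, b n ≤ a n) (hu : ∀ n, a n ≤ b n + m n * e n) :
    Tendsto (fun n => a n / b n) atTop (𝓝 1) := by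
  have h1 : Tendsto (fun n => 1 + e n) atTop (𝓝 1) := by simpa using he.const_add 1
  refine tendsto_of_tendsto_of_tendsto_of_le_of_le' tendsto_const_nhds h1
    (Eventually.of_forall fun n => (one_le_div (hb n)).2 (hl n)) ?_
  filter_upwards [hm] with n hn
  rw [div_le_iff₀ (hb n)]
  nlinarith [hu n, mul_le_mul_of_nonneg_right hn (he0 n)]

end Asymptotics

theorem stmt3 (q : ℕ) (F : Type) [Field F] [Fintype F] (hq : Fintype.card F = q) :
    ∃ A > (0 : ℝ), ∃ ε > (0 : ℝ), ∀ k : ℕ → ℕ, (∀ n, k n ≤ n) → StarCond A ε k →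
      Tendsto (fun n : ℕ =>
          ((numClassesDim F (PermGroup F n) (k n) : ℝ) /
            (numClasses F (PermGroup F n) : ℝ)) /
          (qBinom q n (k n) / Sq q n))
        atTop (𝓝 1) := by
  refine ⟨1, one_pos, 1 / 40, by norm_num, fun k hk hstar => ?_⟩
  subst hq
  have hq2 : 2 ≤ Fintype.card F := Fintype.one_lt_card
  have hq1 : (1 : ℝ) < Fintype.card F := by exact_mod_cast hq2
  set c : ℝ := (Fintype.card F : ℝ) ^ (-(1 / 40) : ℝ) with hc
  have hc0 : 0 ≤ c := by positivity
  have hc1 : c < 1 := Real.rpow_lt_one_of_one_lt_of_neg hq1 (by norm_num)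
  let e : ℕ → ℝ := fun n => 16 * ((n : ℝ) + 1) ^ 2 * ((1 + n * c ^ n) ^ n - 1)
  let m : ℕ → ℝ := fun n => (Fintype.card F : ℝ) ^ ((n : ℝ) ^ 2 / 4 - n / 40)
  have he : Tendsto e atTop (𝓝 0) := tendsto_pow_mul_one_add_pow_sub_one hc0 hc1
  have he0 : ∀ n, 0 ≤ e n := fun n => by
    have : (1 : ℝ) ≤ (1 + n * c ^ n) ^ n := one_le_pow₀ (le_add_of_nonneg_right (by positivity))
    exact mul_nonneg (by positivity) (by linarith)
  have hm : ∀ᶠ n in atTop, m n ≤ qBinom (Fintype.card F) n (k n) := by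
    filter_upwards [hstar.eventually_le_atBot 0] with n hn
    refine le_trans ?_ (pow_le_qBinom hq2 (hk n))
    rw [← Real.rpow_natCast, Nat.cast_mul, Nat.cast_sub (hk n)]
    apply Real.rpow_le_rpow_of_exponent_le hq1.le
    have := Real.sqrt_nonneg (n : ℝ)
    linarith
  have hsum := sum_erase_one_stableBound_le hq2
  have hdim := tendsto_div_one_of_bounds (fun n => qBinom_pos hq2 (hk n)) hm he he0
    (fun n => (numClassesDim_bounds F (hk n)).1)
    (fun n => (numClassesDim_bounds F (hk n)).2.trans (add_le_add_right (hsum n) _))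
  have htot := tendsto_div_one_of_bounds (fun n => Sq_pos hq2)
    (hm.mono fun n hn => hn.trans (qBinom_le_Sq hq2 (hk n))) he he0
    (fun n => (numClasses_bounds F n).1)
    (fun n => (numClasses_bounds F n).2.trans (add_le_add_right (hsum n) _))
  have h := hdim.div htot one_ne_zero
  rw [div_one] at h
  exact h.congr fun n => (div_div_div_eq_of_mul (qBinom_pos hq2 (hk n)).ne' (Sq_pos hq2).ne'
    (by positivity)).symm
end

section
/- Let q = p^h with p prime and h ≥ 1. There exist real constants A > 0 and ε > 0 such that for every function k : ℕ → ℕ satisfying k(n) ≤ n for all n and lim_{n→∞} ( n²/4 − ε·n + A·√n − k(n)·(n − k(n)) ) = −∞ (condition (⋆)), the number N^Γ_{k(n),n} of semilinear equivalence classes of k(n)-dimensional linear codes in F_q^n satisfies N^Γ_{k(n),n} ∼ binom(n, k(n))_q / ( h · n! · (q−1)^{n−1} ) as n → ∞. -/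
open Filter Matrix
open scoped Topology

/-! ### Counting subspaces over a finite field -/

section Counting

open Module

lemma Set.ncard_mul_le_of_rel {α β : Type*} [Finite α] [Finite β] (s : Set α) (t : Set β)
    (r : α → β → Prop) {a b : ℝ}
    (hs : ∀ x ∈ s, a ≤ ({y | y ∈ t ∧ r x y}.ncard : ℝ))
    (ht : ∀ y ∈ t, ({x | x ∈ s ∧ r x y}.ncard : ℝ) ≤ b) :
    (s.ncard : ℝ) * a ≤ t.ncard * b := by
  classical
  have := Fintype.ofFinite α
  have := Fintype.ofFinite β
  have key := Finset.sum_card_bipartiteAbove_eq_sum_card_bipartiteBelow r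
    (s := s.toFinset) (t := t.toFinset)
  have key' : ∑ x ∈ s.toFinset, ({y | y ∈ t ∧ r x y}.ncard : ℝ)
      = ∑ y ∈ t.toFinset, ({x | x ∈ s ∧ r x y}.ncard : ℝ) := by
    simp only [Set.ncard_eq_toFinset_card']
    have h1 : ∀ x, {y | y ∈ t ∧ r x y}.toFinset = t.toFinset.bipartiteAbove r x := by
      intro x; ext; simp
    have h2 : ∀ y, {x | x ∈ s ∧ r x y}.toFinset = s.toFinset.bipartiteBelow r y := by
      intro x; ext; simp
    simp only [h1, h2]
    exact_mod_cast key
  have l1 := Finset.sum_le_sum fun x (hx : x ∈ s.toFinset) => hs x (by simpa using hx)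
  have l2 := Finset.sum_le_sum fun y (hy : y ∈ t.toFinset) => ht y (by simpa using hy)
  simpa [Set.ncard_eq_toFinset_card'] using l1.trans (key'.le.trans l2)

lemma Set.ncard_mul_eq_of_rel {α β : Type*} [Finite α] [Finite β] (s : Set α) (t : Set β)
    (r : α → β → Prop) {a b : ℝ}
    (hs : ∀ x ∈ s, ({y | y ∈ t ∧ r x y}.ncard : ℝ) = a)
    (ht : ∀ y ∈ t, ({x | x ∈ s ∧ r x y}.ncard : ℝ) = b) :
    (s.ncard : ℝ) * a = t.ncard * b :=
  le_antisymm
    (Set.ncard_mul_le_of_rel s t r (fun x hx => (hs x hx).ge) fun y hy => (ht y hy).le)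
    (Set.ncard_mul_le_of_rel t s (fun y x => r x y) (fun y hy => (ht y hy).ge)
      fun x hx => (hs x hx).le)

variable {F V : Type*} [Field F] [AddCommGroup V] [Module F V]

lemma Submodule.ncard_coe [Finite V] (W : Submodule F V) :
    (W : Set V).ncard = Nat.card F ^ finrank F W := by
  rw [← Module.natCard_eq_pow_finrank (K := F) (V := W)]
  exact (Nat.card_coe_set_eq _).symm

lemma Submodule.ncard_sdiff [Finite V] {X W : Submodule F V} (h : X ≤ W) :
    (((W : Set V) \ X).ncard : ℝ) = (Nat.card F : ℝ) ^ finrank F W - (Nat.card F : ℝ) ^ finrank F X := by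
  have := Set.ncard_sdiff_add_ncard_of_subset (s := (X : Set V)) (t := W) h
  rw [Submodule.ncard_coe, Submodule.ncard_coe] at this
  rw [eq_sub_iff_add_eq]
  exact_mod_cast this

variable (F) in
lemma two_le_natCard_cast [Finite F] : (2 : ℝ) ≤ Nat.card F := by
  exact_mod_cast Finite.one_lt_card (α := F)

/-- The number of `k`-dimensional subspaces between `X` and `U`. -/
theorem ncard_between [Finite F] [Finite V] (U : Submodule F V) (k j : ℕ) :
    ∀ X : Submodule F V, X ≤ U → finrank F X + j = k →
    ({W : Submodule F V | X ≤ W ∧ W ≤ U ∧ finrank F W = k}.ncard : ℝ) =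
      ∏ i ∈ Finset.range j,
        ((Nat.card F : ℝ) ^ finrank F U - (Nat.card F : ℝ) ^ (finrank F X + i)) /
          ((Nat.card F : ℝ) ^ k - (Nat.card F : ℝ) ^ (finrank F X + i)) := by
  have hq := two_le_natCard_cast F
  induction j with
  | zero =>
    intro X hXU hk
    have : {W : Submodule F V | X ≤ W ∧ W ≤ U ∧ finrank F W = k} = {X} := by
      ext W
      simp only [Set.mem_ofPred_eq, Set.mem_singleton_iff]
      constructor
      · rintro ⟨h1, -, h2⟩
        exact (Submodule.eq_of_le_of_finrank_eq h1 (by omega)).symm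
      · rintro rfl
        exact ⟨le_rfl, hXU, by omega⟩
    simp [this]
  | succ j ih =>
    intro X hXU hk
    have key := Set.ncard_mul_eq_of_rel
      {W : Submodule F V | X ≤ W ∧ W ≤ U ∧ finrank F W = k} ((U : Set V) \ X)
      (fun W y => y ∈ W)
      (a := (Nat.card F : ℝ) ^ k - (Nat.card F : ℝ) ^ finrank F X)
      (b := ∏ i ∈ Finset.range j,
        ((Nat.card F : ℝ) ^ finrank F U - (Nat.card F : ℝ) ^ (finrank F X + 1 + i)) /
          ((Nat.card F : ℝ) ^ k - (Nat.card F : ℝ) ^ (finrank F X + 1 + i)))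
      (by
        rintro W ⟨h1, h2, h3⟩
        rw [← h3, ← Submodule.ncard_sdiff h1]
        congr 2
        ext y
        simp only [Set.mem_sdiff, SetLike.mem_coe, Set.mem_ofPred_eq]
        exact ⟨fun h => ⟨h.2, h.1.2⟩, fun h => ⟨⟨h2 h.1, h.2⟩, h.1⟩⟩)
      (by
        rintro y ⟨hyU, hyX⟩
        have hf := Submodule.finrank_sup_span_singleton (K := F) hyX
        rw [← hf, ← ih (X ⊔ Submodule.span F {y})
          (sup_le hXU ((Submodule.span_singleton_le_iff_mem _ _).2 hyU)) (by omega)]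
        congr 2
        ext W
        simp only [Set.mem_ofPred_eq, sup_le_iff, Submodule.span_singleton_le_iff_mem]
        tauto)
    rw [Submodule.ncard_sdiff hXU] at key
    have hne : (Nat.card F : ℝ) ^ k - (Nat.card F : ℝ) ^ finrank F X ≠ 0 := by
      have : (Nat.card F : ℝ) ^ finrank F X < (Nat.card F : ℝ) ^ k :=
        pow_lt_pow_right₀ (by linarith) (by omega)
      linarith
    simp only [add_assoc, add_comm 1] at key
    rw [Finset.prod_range_succ', eq_div_of_mul_eq hne key, add_zero]
    ring

lemma quarter_le_prod_one_sub_pow {x : ℝ} (hx0 : 0 ≤ x) (hx : x ≤ 1 / 2) (j : ℕ) :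
    1 / 4 ≤ ∏ i ∈ Finset.range j, (1 - x ^ (i + 1)) := by
  have key : ∀ j : ℕ, 1 / 4 + x ^ (j + 2) ≤ ∏ i ∈ Finset.range (j + 1), (1 - x ^ (i + 1)) := by
    intro j
    induction j with
    | zero => simp; nlinarith
    | succ j ih =>
      rw [Finset.prod_range_succ]
      have h1 : x ^ (j + 2) ≤ 1 / 4 := by
        calc x ^ (j + 2) ≤ x ^ 2 := pow_le_pow_of_le_one hx0 (by linarith) (by omega)
          _ ≤ 1 / 4 := by nlinarith
      have h2 : 0 ≤ x ^ (j + 2) := by positivity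
      calc _ ≤ (1 / 4 + x ^ (j + 2)) * (1 - x ^ (j + 1 + 1)) := by
            rw [show j + 1 + 2 = (j + 2) + 1 by ring, pow_succ]
            change _ ≤ (1 / 4 + x ^ (j + 2)) * (1 - x ^ (j + 2))
            nlinarith
        _ ≤ _ := by
            apply mul_le_mul_of_nonneg_right ih
            change 0 ≤ 1 - x ^ (j + 2)
            linarith
  cases j with
  | zero => norm_num
  | succ j => exact le_trans (by have := pow_nonneg hx0 (j + 2); linarith) (key j)

theorem ncard_between_le [Finite F] [Finite V] {U X : Submodule F V} {k u : ℕ} (hXU : X ≤ U)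
    (hk : finrank F X ≤ k) (hku : k ≤ u) (hu : finrank F U ≤ u) :
    ({W : Submodule F V | X ≤ W ∧ W ≤ U ∧ finrank F W = k}.ncard : ℝ) ≤
      4 * (Nat.card F : ℝ) ^ ((k - finrank F X) * (u - k)) := by
  have hq := two_le_natCard_cast F
  set q : ℝ := (Nat.card F : ℝ)
  have hq0 : 0 < q := by linarith
  obtain ⟨j, rfl⟩ := Nat.exists_eq_add_of_le hk
  set d := finrank F X
  rw [ncard_between U (d + j) j X hXU rfl]
  have hterm : ∀ i ∈ Finset.range j, (q ^ finrank F U - q ^ (d + i)) / (q ^ (d + j) - q ^ (d + i))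
      ≤ q ^ (u - (d + j)) * (1 - q⁻¹ ^ (j - 1 - i + 1))⁻¹ := by
    intro i hi
    rw [Finset.mem_range] at hi
    have hlt : q ^ (d + i) < q ^ (d + j) := pow_lt_pow_right₀ (by linarith) (by omega)
    have e1 : q ^ (d + j) - q ^ (d + i) = q ^ (d + j) * (1 - q⁻¹ ^ (j - 1 - i + 1)) := by
      rw [mul_sub, mul_one, show d + j = d + i + (j - 1 - i + 1) by omega, pow_add, mul_assoc,
        ← mul_pow, mul_inv_cancel₀ hq0.ne', one_pow, mul_one]
    have e2 : q ^ u = q ^ (u - (d + j)) * q ^ (d + j) := by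
      rw [← pow_add]; congr 1; omega
    have hpos : 0 < 1 - q⁻¹ ^ (j - 1 - i + 1) := by
      have : 0 < q ^ (d + j) - q ^ (d + i) := by linarith
      rw [e1] at this
      exact pos_of_mul_pos_right this (by positivity)
    rw [div_le_iff₀ (by linarith), e1]
    calc q ^ finrank F U - q ^ (d + i) ≤ q ^ finrank F U := by
          linarith [pow_pos hq0 (d + i)]
      _ ≤ q ^ u := pow_le_pow_right₀ (by linarith) hu
      _ = _ := by
          generalize 1 - q⁻¹ ^ (j - 1 - i + 1) = c at hpos
          rw [e2]
          field_simp
  have hnonneg : ∀ i ∈ Finset.range j,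
      0 ≤ q ^ (u - (d + j)) * (1 - q⁻¹ ^ (j - 1 - i + 1))⁻¹ := by
    intro i _
    have : q⁻¹ ^ (j - 1 - i + 1) ≤ 1 := pow_le_one₀ (by positivity) (inv_le_one_of_one_le₀ (by linarith))
    have := inv_nonneg.2 (sub_nonneg.2 this)
    positivity
  by_cases hfd : finrank F U < d + j
  · rw [← ncard_between U (d + j) j X hXU rfl]
    have : {W : Submodule F V | X ≤ W ∧ W ≤ U ∧ finrank F W = d + j} = ∅ := by
      ext W
      simp only [Set.mem_ofPred_eq, Set.mem_empty_iff_false, iff_false]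
      rintro ⟨-, h1, h2⟩
      have := Submodule.finrank_mono h1
      omega
    rw [this]
    simp
    positivity
  push Not at hfd
  calc _ ≤ ∏ i ∈ Finset.range j, q ^ (u - (d + j)) * (1 - q⁻¹ ^ (j - 1 - i + 1))⁻¹ := by
        refine Finset.prod_le_prod (fun i hi => ?_) hterm
        rw [Finset.mem_range] at hi
        have h1 : q ^ (d + i) ≤ q ^ (d + j) := pow_le_pow_right₀ (by linarith) (by omega)
        have h2 : q ^ (d + i) ≤ q ^ finrank F U := pow_le_pow_right₀ (by linarith) (by omega)
        exact div_nonneg (by linarith) (by linarith)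
    _ = q ^ (j * (u - (d + j))) * (∏ i ∈ Finset.range j, (1 - q⁻¹ ^ (i + 1)))⁻¹ := by
        rw [Finset.prod_mul_distrib, Finset.prod_const, Finset.card_range, ← pow_mul,
          Finset.prod_inv_distrib, Finset.prod_range_reflect (fun i => 1 - q⁻¹ ^ (i + 1)),
          mul_comm j]
    _ ≤ q ^ (j * (u - (d + j))) * (1 / 4)⁻¹ := by
        gcongr
        exact quarter_le_prod_one_sub_pow (by positivity)
          (by rw [one_div]; exact inv_anti₀ (by norm_num) hq) j
    _ = _ := by rw [Nat.add_sub_cancel_left]; ring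

end Counting

/-! ### Subspaces invariant under a semilinear map -/

section Invariant

open Module

variable {F V : Type*} [Field F] [AddCommGroup V] [Module F V]

/-- The vectors `y` such that `y` and `T y` are linearly dependent modulo `X`. -/
def DependentMod (T : V →+ V) (X : Submodule F V) (y : V) : Prop :=
  y ∈ X ∨ ∃ c : F, T y - c • y ∈ X

lemma exists_scalar_of_dependentMod (T : V →+ V) {X W : Submodule F V} [Finite V] (hXW : X ≤ W)
    (hd : finrank F X + 2 ≤ finrank F W) (h : ∀ y ∈ W, DependentMod T X y) :
    ∃ c : F, ∀ y ∈ W, T y - c • y ∈ X := by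
  obtain ⟨z, hzW, hzX⟩ : ∃ z ∈ W, z ∉ X := by
    by_contra! hc
    have := Submodule.finrank_mono (R := F) (show W ≤ X from hc)
    omega
  obtain ⟨c, hc⟩ := (h z hzW).resolve_left hzX
  have hf := Submodule.finrank_sup_span_singleton (K := F) hzX
  set Y := X ⊔ Submodule.span F {z} with hY
  have hXY : X ≤ Y := le_sup_left
  have hzY : z ∈ Y := Submodule.mem_sup_right (Submodule.mem_span_singleton_self z)
  have hYW : Y ≤ W := sup_le hXW ((Submodule.span_singleton_le_iff_mem _ _).2 hzW)
  have hmem : ∀ (y : V) (a b : F), a ≠ 0 → a • y + b • z ∈ X → y ∈ Y := by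
    intro y a b ha hab
    have h1 : a • y ∈ Y := by
      have := Y.sub_mem (hXY hab) (Y.smul_mem b hzY)
      simpa using this
    exact (Y.smul_mem_iff ha).1 h1
  have hout : ∀ y ∈ W, y ∉ Y → T y - c • y ∈ X := by
    intro y hyW hyY
    obtain ⟨e, he⟩ := (h y hyW).resolve_left fun h => hyY (hXY h)
    obtain ⟨g, hg⟩ := (h (y + z) (W.add_mem hyW hzW)).resolve_left fun h => by
      refine hyY (hmem y 1 1 one_ne_zero ?_)
      simpa using h
    have h1 : (e - g) • y + (c - g) • z ∈ X := by
      have := X.sub_mem hg (X.add_mem he hc)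
      rw [map_add] at this
      convert this using 1
      module
    have h2 : e = g := by
      by_contra hne
      exact hyY (hmem y _ _ (sub_ne_zero.2 hne) h1)
    subst h2
    have h3 : c = e := by
      by_contra hne
      rw [sub_self, zero_smul, zero_add, X.smul_mem_iff (sub_ne_zero.2 hne)] at h1
      exact hzX h1
    rwa [h3]
  obtain ⟨w, hwW, hwY⟩ : ∃ w ∈ W, w ∉ Y := by
    by_contra! hc
    have := Submodule.finrank_mono (R := F) (show W ≤ Y from hc)
    omega
  refine ⟨c, fun y hy => ?_⟩
  by_cases hyY : y ∈ Y
  · have h1 := hout (y + w) (W.add_mem hy hwW) fun h => hwY (by simpa using Y.sub_mem h hyY)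
    have := X.sub_mem h1 (hout w hwW hwY)
    rw [map_add] at this
    convert this using 1
    module
  · exact hout y hy hyY

lemma finrank_sup_of_not_dependentMod [Finite V] {T : V →+ V} {X : Submodule F V} {y : V}
    (h : ¬ DependentMod T X y) :
    finrank F ↥(X ⊔ Submodule.span F {y} ⊔ Submodule.span F {T y}) = finrank F X + 2 := by
  rw [DependentMod, not_or, not_exists] at h
  rw [Submodule.finrank_sup_span_singleton, Submodule.finrank_sup_span_singleton h.1]
  intro hT
  obtain ⟨x, hx, z, hz, hxz⟩ := Submodule.mem_sup.1 hT
  obtain ⟨c, rfl⟩ := Submodule.mem_span_singleton.1 hz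
  refine h.2 c ?_
  rw [← hxz]
  simpa using hx

lemma pow_le_four_mul_ncard_not_dependentMod [Finite F] [Finite V] {T : V →+ V}
    {X W : Submodule F V} (hd : finrank F X + 3 ≤ finrank F W)
    (h : ∃ y ∈ W, ¬ DependentMod T X y) :
    (Nat.card F : ℝ) ^ finrank F W ≤ 4 * {y | y ∈ W ∧ ¬ DependentMod T X y}.ncard := by
  obtain ⟨y, hyW, hy⟩ := h
  have hq := two_le_natCard_cast F
  set q : ℝ := (Nat.card F : ℝ) with hqdef
  set Y := X ⊔ Submodule.span F {y} ⊔ Submodule.span F {T y} with hY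
  have hf : finrank F Y = finrank F X + 2 := finrank_sup_of_not_dependentMod hy
  have hXY : X ≤ Y := le_sup_left.trans le_sup_left
  have hyY : y ∈ Y :=
    Submodule.mem_sup_left (Submodule.mem_sup_right (Submodule.mem_span_singleton_self y))
  have hTY : T y ∈ Y := Submodule.mem_sup_right (Submodule.mem_span_singleton_self _)
  set G := {y | y ∈ W ∧ ¬ DependentMod T X y} with hG
  have hcover : (W : Set V) ⊆ Y ∪ (G ∪ (fun z => z - y) '' G) := by
    intro z hz
    by_contra hcon
    simp only [Set.mem_union, SetLike.mem_coe, not_or, Set.mem_image, not_exists, not_and] at hcon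
    obtain ⟨hzY, hzG, hzyG⟩ := hcon
    have b1 : DependentMod T X z := by
      by_contra hb
      exact hzG ⟨hz, hb⟩
    have b2 : DependentMod T X (z + y) := by
      by_contra hb
      exact hzyG (z + y) ⟨W.add_mem hz hyW, hb⟩ (by simp)
    obtain ⟨a, ha⟩ := b1.resolve_left fun h => hzY (hXY h)
    obtain ⟨b, hb⟩ := b2.resolve_left fun h => hzY (by simpa using Y.sub_mem (hXY h) hyY)
    have h1 : (T y - b • y) + (a - b) • z ∈ X := by
      have := X.sub_mem hb ha
      rw [map_add] at this
      convert this using 1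
      module
    have hab : a = b := by
      by_contra hne
      have h2 : (a - b) • z ∈ Y := by
        have := Y.sub_mem (hXY h1) (Y.sub_mem hTY (Y.smul_mem b hyY))
        simpa using this
      exact hzY ((Y.smul_mem_iff (sub_ne_zero.2 hne)).1 h2)
    rw [hab, sub_self, zero_smul, add_zero] at h1
    exact hy (Or.inr ⟨b, h1⟩)
  have hcard : (W : Set V).ncard ≤ (Y : Set V).ncard + (G.ncard + G.ncard) :=
    (Set.ncard_le_ncard hcover).trans <| (Set.ncard_union_le _ _).trans <|
      Nat.add_le_add_left ((Set.ncard_union_le _ _).trans <|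
        Nat.add_le_add_left Set.ncard_image_le _) _
  rw [Submodule.ncard_coe, Submodule.ncard_coe, hf] at hcard
  have hcard' : q ^ finrank F W ≤ q ^ (finrank F X + 2) + (G.ncard + G.ncard) := by
    rw [hqdef]
    exact_mod_cast hcard
  have : 2 * q ^ (finrank F X + 2) ≤ q ^ finrank F W := by
    calc 2 * q ^ (finrank F X + 2) ≤ q * q ^ (finrank F X + 2) := by gcongr
      _ = q ^ (finrank F X + 3) := by ring
      _ ≤ _ := pow_le_pow_right₀ (by linarith) hd
  linarith

/-- If every `W` in a family of `T`-invariant `k`-spaces contains vectors independent of their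
image modulo any subspace of dimension at most `D - 2`, then the family is small. -/
lemma ncard_le_of_exists_not_dependentMod [Finite F] [Finite V] (T : V →+ V) {k D : ℕ}
    (S : Set (Submodule F V)) (hk : k ≤ finrank F V)
    (hSk : ∀ W ∈ S, finrank F W = k) (hST : ∀ W ∈ S, ∀ x ∈ W, T x ∈ W) (hD : D + 1 ≤ k)
    (hS : ∀ W ∈ S, ∀ X ≤ W, finrank F X + 2 ≤ D → ∃ y ∈ W, ¬ DependentMod T X y) (r : ℕ) :
    ∀ X : Submodule F V, finrank F X + 2 * r = D →
      ({W | W ∈ S ∧ X ≤ W}.ncard : ℝ) ≤ (4 * (Nat.card F : ℝ) ^ (finrank F V - k)) ^ r *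
        (4 * (Nat.card F : ℝ) ^ ((k - D) * (finrank F V - k))) := by
  have hq := two_le_natCard_cast F
  induction r with
  | zero =>
    intro X hX
    have h1 := ncard_between_le (U := ⊤) (X := X) (k := k) (u := finrank F V) le_top (by omega) hk
      (by simp)
    rw [pow_zero, one_mul, ← hX, mul_zero, add_zero]
    refine le_trans ?_ h1
    refine Nat.cast_le.2 (Set.ncard_le_ncard ?_)
    rintro W ⟨hW, hXW⟩
    exact ⟨hXW, le_top, hSk W hW⟩
  | succ r ih =>
    intro X hX
    set q : ℝ := (Nat.card F : ℝ) with hqdef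
    have key := Set.ncard_mul_le_of_rel {W | W ∈ S ∧ X ≤ W} {y | ¬ DependentMod T X y}
      (fun W y => y ∈ W) (a := q ^ k / 4)
      (b := (4 * q ^ (finrank F V - k)) ^ r * (4 * q ^ ((k - D) * (finrank F V - k))))
      (by
        rintro W ⟨hW, hXW⟩
        have := pow_le_four_mul_ncard_not_dependentMod (T := T) (X := X) (W := W)
          (by rw [hSk W hW]; omega) (hS W hW X hXW (by omega))
        rw [hSk W hW] at this
        simp only [Set.mem_ofPred_eq, and_comm (b := _ ∈ W)]
        linarith)
      (by
        intro y hy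
        refine le_trans ?_ (ih (X ⊔ Submodule.span F {y} ⊔ Submodule.span F {T y}) ?_)
        · refine Nat.cast_le.2 (Set.ncard_le_ncard ?_)
          rintro W ⟨⟨hW, hXW⟩, hyW⟩
          refine ⟨hW, sup_le (sup_le hXW ?_) ?_⟩
          · exact (Submodule.span_singleton_le_iff_mem _ _).2 hyW
          · exact (Submodule.span_singleton_le_iff_mem _ _).2 (hST W hW y hyW)
        · rw [finrank_sup_of_not_dependentMod hy]
          omega)
    have ht : ({y | ¬ DependentMod T X y}.ncard : ℝ) ≤ q ^ finrank F V := by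
      have := Set.ncard_le_ncard (Set.subset_univ {y | ¬ DependentMod T X y})
      rw [Set.ncard_univ, Module.natCard_eq_pow_finrank (K := F)] at this
      rw [hqdef]
      exact_mod_cast this
    have hqk : 0 < q ^ k := by positivity
    have e : q ^ finrank F V = q ^ (finrank F V - k) * q ^ k := by
      rw [← pow_add]; congr 1; omega
    refine le_of_mul_le_mul_right (key.trans ?_) (show 0 < q ^ k / 4 by positivity)
    calc _ ≤ q ^ finrank F V *
          ((4 * q ^ (finrank F V - k)) ^ r * (4 * q ^ ((k - D) * (finrank F V - k)))) := by gcongr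
      _ = _ := by rw [e]; ring

end Invariant

section Semilinear

open Module

variable {F V : Type*} [Field F] [AddCommGroup V] [Module F V]

theorem ncard_invariant_le_of_semilinear [Finite F] [Finite V] (T : V →+ V)
    (hT : Function.Injective T) (σ : F ≃+* F) (hσ : σ ≠ RingEquiv.refl F)
    (hTσ : ∀ (a : F) (x : V), T (a • x) = σ a • T x) {k r : ℕ} (hk : k ≤ finrank F V)
    (hr : 2 * r + 1 ≤ k) :
    ({W : Submodule F V | finrank F W = k ∧ ∀ x ∈ W, T x ∈ W}.ncard : ℝ) ≤
      (4 * (Nat.card F : ℝ) ^ (finrank F V - k)) ^ r *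
        (4 * (Nat.card F : ℝ) ^ ((k - 2 * r) * (finrank F V - k))) := by
  have := ncard_le_of_exists_not_dependentMod T (k := k) (D := 2 * r)
    {W : Submodule F V | finrank F W = k ∧ ∀ x ∈ W, T x ∈ W} hk (fun W hW => hW.1)
    (fun W hW => hW.2) hr ?_ r ⊥ (by simp)
  · simpa using this
  rintro W ⟨hWk, hW⟩ X hXW hX
  by_contra! hcon
  obtain ⟨c, hc⟩ := exists_scalar_of_dependentMod T hXW (by omega) hcon
  obtain ⟨a, ha⟩ : ∃ a, σ a ≠ a := by
    by_contra! h
    exact hσ (RingEquiv.ext h)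
  have hlt : finrank F X < finrank F W := by omega
  have hc0 : c = 0 := by
    by_contra hne
    have hWX : W ≤ X := by
      intro y hy
      have h1 := X.sub_mem (X.smul_mem (σ a) (hc y hy)) (hc (a • y) (W.smul_mem a hy))
      rw [hTσ] at h1
      have h2 : (c * (a - σ a)) • y ∈ X := by
        convert h1 using 1
        module
      exact (X.smul_mem_iff (mul_ne_zero hne (sub_ne_zero.2 (Ne.symm ha)))).1 h2
    exact absurd (Submodule.finrank_mono hWX) (by omega)
  have himg : T '' (W : Set V) ⊆ X := by
    rintro _ ⟨y, hy, rfl⟩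
    simpa [hc0] using hc y hy
  have h1 := Set.ncard_le_ncard himg
  rw [Set.ncard_image_of_injective _ hT, Submodule.ncard_coe, Submodule.ncard_coe] at h1
  exact absurd (Nat.pow_lt_pow_right (Finite.one_lt_card (α := F)) hlt) (by omega)

lemma Submodule.exists_le_finrank_eq [Module.Finite F V] (Z : Submodule F V) {j : ℕ}
    (hj : j ≤ finrank F Z) : ∃ Y ≤ Z, finrank F Y = j := by
  induction j with
  | zero => exact ⟨⊥, bot_le, by simp⟩
  | succ j ih =>
    obtain ⟨Y, hYZ, hY⟩ := ih (by omega)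
    obtain ⟨z, hz, hzY⟩ : ∃ z ∈ Z, z ∉ Y := by
      by_contra! h
      have := Submodule.finrank_mono (R := F) (show Z ≤ Y from h)
      omega
    exact ⟨Y ⊔ Submodule.span F {z},
      sup_le hYZ ((Submodule.span_singleton_le_iff_mem _ _).2 hz),
      by rw [Submodule.finrank_sup_span_singleton hzY, hY]⟩

/-- There are few `k`-spaces meeting a given proper subspace `U` in a large subspace. -/
lemma ncard_finrank_inf_ge_le [Finite F] [Finite V] (U : Submodule F V) {k j u : ℕ}
    (hk : k ≤ finrank F V) (hjk : j ≤ k) (hju : j ≤ u) (hu : finrank F U ≤ u) :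
    ({W : Submodule F V | finrank F W = k ∧ j ≤ finrank F ↥(W ⊓ U)}.ncard : ℝ) ≤
      16 * (Nat.card F : ℝ) ^ (j * (u - j) + (k - j) * (finrank F V - k)) := by
  have key := Set.ncard_mul_le_of_rel
    {W : Submodule F V | finrank F W = k ∧ j ≤ finrank F ↥(W ⊓ U)}
    {Y : Submodule F V | ⊥ ≤ Y ∧ Y ≤ U ∧ finrank F Y = j} (fun W Y => Y ≤ W)
    (a := 1) (b := 4 * (Nat.card F : ℝ) ^ ((k - j) * (finrank F V - k)))
    (by
      rintro W ⟨hW, hj⟩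
      obtain ⟨Y, hY, hYj⟩ := Submodule.exists_le_finrank_eq _ hj
      rw [Nat.one_le_cast, Nat.one_le_iff_ne_zero, ← Nat.pos_iff_ne_zero, Set.ncard_pos]
      exact ⟨Y, ⟨bot_le, hY.trans inf_le_right, hYj⟩, hY.trans inf_le_left⟩)
    (by
      rintro Y ⟨-, -, hY⟩
      have := ncard_between_le (U := ⊤) (X := Y) (k := k) (u := finrank F V) le_top
        (by omega) hk (by simp)
      rw [hY] at this
      refine le_trans (Nat.cast_le.2 (Set.ncard_le_ncard ?_)) this
      rintro W ⟨⟨hW, -⟩, hYW⟩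
      exact ⟨hYW, le_top, hW⟩)
  have h2 := ncard_between_le (U := U) (X := ⊥) (k := j) bot_le (by simp) hju hu
  rw [finrank_bot, Nat.sub_zero] at h2
  rw [mul_one] at key
  refine key.trans ((mul_le_mul_of_nonneg_right h2 (by positivity)).trans_eq ?_)
  rw [pow_add]
  ring

lemma finrank_le_add_finrank_inf_eigenspace [Module.Finite F V] (T : End F V) {X W : Submodule F V}
    {c : F} (h : ∀ y ∈ W, T y - c • y ∈ X) :
    finrank F W ≤ finrank F X + finrank F ↥(W ⊓ T.eigenspace c) := by
  have h1 := LinearMap.finrank_range_add_finrank_ker ((T - algebraMap F (End F V) c).domRestrict W)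
  have h2 : LinearMap.range ((T - algebraMap F (End F V) c).domRestrict W) ≤ X := by
    rintro _ ⟨⟨y, hy⟩, rfl⟩
    exact h y hy
  have h3 := Submodule.finrank_mono h2
  rw [LinearMap.ker_domRestrict] at h1
  have h4 : finrank F ↥(W ⊓ T.eigenspace c) =
      finrank F ↥((LinearMap.ker (T - algebraMap F (End F V) c)).comap W.subtype) := by
    rw [Module.End.eigenspace_def, ← Submodule.map_comap_subtype, Submodule.finrank_map_subtype_eq]
    rfl
  rw [h4]
  omega

theorem ncard_invariant_le_of_eigenspace [Finite F] [Finite V] (T : End F V) {k r u : ℕ}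
    (hk : k ≤ finrank F V) (hr : 2 * r + 3 ≤ k) (hu : ∀ c, finrank F (T.eigenspace c) ≤ u)
    (hru : k - 2 * r ≤ u) :
    ({W : Submodule F V | finrank F W = k ∧ ∀ x ∈ W, T x ∈ W}.ncard : ℝ) ≤
      (4 * (Nat.card F : ℝ) ^ (finrank F V - k)) ^ (r + 1) *
        (4 * (Nat.card F : ℝ) ^ ((k - 2 * (r + 1)) * (finrank F V - k))) +
      Nat.card F * (16 * (Nat.card F : ℝ) ^
        ((k - 2 * r) * (u - (k - 2 * r)) + 2 * r * (finrank F V - k))) := by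
  have := Fintype.ofFinite F
  set S := {W : Submodule F V | (finrank F W = k ∧ ∀ x ∈ W, T x ∈ W) ∧
    ∀ c, finrank F ↥(W ⊓ T.eigenspace c) < k - 2 * r}
  set B := fun c : F =>
    {W : Submodule F V | finrank F W = k ∧ k - 2 * r ≤ finrank F ↥(W ⊓ T.eigenspace c)}
  have hsub : {W : Submodule F V | finrank F W = k ∧ ∀ x ∈ W, T x ∈ W} ⊆
      S ∪ ⋃ c ∈ (Finset.univ : Finset F), B c := by
    intro W hW
    by_cases hg : ∀ c, finrank F ↥(W ⊓ T.eigenspace c) < k - 2 * r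
    · exact Or.inl ⟨hW, hg⟩
    · push Not at hg
      obtain ⟨c, hc⟩ := hg
      exact Or.inr (Set.mem_biUnion (Finset.mem_coe.2 (Finset.mem_univ c)) ⟨hW.1, hc⟩)
  have hS := ncard_le_of_exists_not_dependentMod (T : V →+ V) (k := k) (D := 2 * (r + 1)) S hk
    (fun W hW => hW.1.1) (fun W hW => hW.1.2) (by omega) (by
      rintro W ⟨⟨hWk, hW⟩, hWc⟩ X hXW hX
      by_contra! hcon
      obtain ⟨c, hc⟩ := exists_scalar_of_dependentMod (T : V →+ V) hXW (by omega) hcon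
      have h1 := finrank_le_add_finrank_inf_eigenspace T (c := c) hc
      have h2 := hWc c
      omega) (r + 1) ⊥ (by simp)
  have hB : ∀ c ∈ (Finset.univ : Finset F), ((B c).ncard : ℝ) ≤ 16 * (Nat.card F : ℝ) ^
        ((k - 2 * r) * (u - (k - 2 * r)) + 2 * r * (finrank F V - k)) := by
    intro c _
    have := ncard_finrank_inf_ge_le (T.eigenspace c) hk (Nat.sub_le k (2 * r)) hru (hu c)
    rwa [show k - (k - 2 * r) = 2 * r by omega] at this
  have hle : ({W : Submodule F V | finrank F W = k ∧ ∀ x ∈ W, T x ∈ W}.ncard : ℝ) ≤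
      S.ncard + ∑ c : F, ((B c).ncard : ℝ) := by
    have h1 := (Set.ncard_le_ncard hsub).trans (Set.ncard_union_le _ _)
    have h2 := h1.trans (Nat.add_le_add_left (Finset.set_ncard_biUnion_le _ B) _)
    exact_mod_cast h2
  refine hle.trans (add_le_add (by simpa using hS) ((Finset.sum_le_sum hB).trans_eq ?_))
  rw [Finset.sum_const, Finset.card_univ, nsmul_eq_mul, Nat.card_eq_fintype_card]

end Semilinear

/-! ### Monomial semilinear maps -/

section Monomial

open Module

variable {F : Type*} [Field F] {n : ℕ}

/-- The semilinear map `x ↦ (i ↦ dᵢ σ(x_{π i}))`. -/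
def semimonomial (σ : F ≃+* F) (π : Equiv.Perm (Fin n)) (d : Fin n → Fˣ) :
    (Fin n → F) ≃+ (Fin n → F) where
  toFun x i := d i * σ (x (π i))
  invFun x i := σ.symm (((d (π.symm i))⁻¹ : Fˣ) * x (π.symm i))
  left_inv x := by ext i; simp
  right_inv x := by ext i; simp
  map_add' x y := by ext i; simp [mul_add]

@[simp]
lemma semimonomial_apply (σ : F ≃+* F) (π : Equiv.Perm (Fin n)) (d : Fin n → Fˣ) (x : Fin n → F)
    (i : Fin n) : semimonomial σ π d x i = d i * σ (x (π i)) := rfl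

lemma semimonomial_smul (σ : F ≃+* F) (π : Equiv.Perm (Fin n)) (d : Fin n → Fˣ) (a : F)
    (x : Fin n → F) : semimonomial σ π d (a • x) = σ a • semimonomial σ π d x := by
  ext i
  simp only [semimonomial_apply, Pi.smul_apply, smul_eq_mul, map_mul]
  ring

/-- The linear map underlying `semimonomial` for the trivial field automorphism. -/
def monomialEnd (π : Equiv.Perm (Fin n)) (d : Fin n → Fˣ) : End F (Fin n → F) where
  toFun := semimonomial (RingEquiv.refl F) π d
  map_add' := map_add _
  map_smul' := semimonomial_smul (RingEquiv.refl F) π d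

open Classical in
/-- The indices where the monomial map given by `π` and `d` differs from the scalar `c`. -/
noncomputable def displaced (π : Equiv.Perm (Fin n)) (d : Fin n → Fˣ) (c : F) : Finset (Fin n) :=
  {i | π i ≠ i ∨ (d i : F) ≠ c}

lemma finrank_eigenspace_monomialEnd_add_le (π : Equiv.Perm (Fin n)) (d : Fin n → Fˣ) (c : F)
    (ord : Fin n → Fin n → Prop) (hord : WellFounded ord) (R : Finset (Fin n))
    (hR : ∀ j ∈ R, ord (π.symm j) j ∨ (π j = j ∧ (d j : F) ≠ c)) :
    finrank F ((monomialEnd π d).eigenspace c) + R.card ≤ n := by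
  have hinj : Function.Injective ((LinearMap.funLeft F F
      (Subtype.val : {j // j ∉ R} → Fin n)).domRestrict ((monomialEnd π d).eigenspace c)) := by
    rw [← LinearMap.ker_eq_bot, LinearMap.ker_eq_bot']
    rintro ⟨x, hx⟩ h0
    rw [Module.End.mem_eigenspace_iff] at hx
    have hx' : ∀ i, (d i : F) * x (π i) = c * x i := fun i => congrFun hx i
    have hz : ∀ j, x j = 0 := by
      intro j
      induction j using hord.induction with
      | _ j ih =>
        by_cases hj : j ∈ R
        · rcases hR j hj with h | ⟨h, hd⟩
          · have := hx' (π.symm j)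
            rw [ih _ h, π.apply_symm_apply, mul_zero] at this
            exact (mul_eq_zero.1 this).resolve_left (Units.ne_zero _)
          · have := hx' j
            rw [h, ← sub_eq_zero, ← sub_mul] at this
            exact (mul_eq_zero.1 this).resolve_left (sub_ne_zero.2 hd)
        · exact congrFun h0 ⟨j, hj⟩
    exact Subtype.ext (funext hz)
  have h1 := LinearMap.finrank_le_finrank_of_injective hinj
  rw [Module.finrank_fintype_fun_eq_card, Fintype.card_subtype_compl, Fintype.card_fin,
    Fintype.card_coe] at h1
  have h2 : R.card ≤ n := by simpa using R.card_le_univ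
  omega

lemma finrank_eigenspace_monomialEnd_le (π : Equiv.Perm (Fin n)) (d : Fin n → Fˣ) (c : F) :
    2 * finrank F ((monomialEnd π d).eigenspace c) + (displaced π d c).card ≤ 2 * n := by
  classical
  have h1 := finrank_eigenspace_monomialEnd_add_le π d c (· < ·) wellFounded_lt
    {j | π.symm j < j ∨ (π j = j ∧ (d j : F) ≠ c)} (by simp)
  have h2 := finrank_eigenspace_monomialEnd_add_le π d c (· > ·) wellFounded_gt
    {j | π.symm j > j ∨ (π j = j ∧ (d j : F) ≠ c)} (by simp)
  have h3 : displaced π d c ⊆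
      ({j | π.symm j < j ∨ (π j = j ∧ (d j : F) ≠ c)} : Finset (Fin n)) ∪
      ({j | π.symm j > j ∨ (π j = j ∧ (d j : F) ≠ c)} : Finset (Fin n)) := by
    intro j hj
    simp only [displaced, Finset.mem_filter, Finset.mem_univ, true_and] at hj
    simp only [Finset.mem_union, Finset.mem_filter, Finset.mem_univ, true_and]
    by_cases hπ : π j = j
    · tauto
    · have : π.symm j ≠ j := fun h => hπ (by rw [π.symm_apply_eq] at h; exact h.symm)
      rcases lt_or_gt_of_ne this with h | h <;> tauto
  have h4 := (Finset.card_le_card h3).trans (Finset.card_union_le _ _)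
  omega

lemma card_displaced_eq_le [Finite F] (c : F) (D : Finset (Fin n)) :
    Nat.card {g : Equiv.Perm (Fin n) × (Fin n → Fˣ) // displaced g.1 g.2 c = D} ≤
      (n * Nat.card F) ^ D.card := by
  have hmem : ∀ g : {g : Equiv.Perm (Fin n) × (Fin n → Fˣ) // displaced g.1 g.2 c = D},
      ∀ i ∉ D, g.1.1 i = i ∧ (g.1.2 i : F) = c := by
    intro g i hi
    rw [← g.2] at hi
    simpa [displaced] using hi
  have hinj : Function.Injective
      (fun (g : {g : Equiv.Perm (Fin n) × (Fin n → Fˣ) // displaced g.1 g.2 c = D})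
        (i : D) => (g.1.1 i, (g.1.2 i : F))) := by
    intro g g' hgg
    have hi : ∀ i, g.1.1 i = g'.1.1 i ∧ (g.1.2 i : F) = g'.1.2 i := by
      intro i
      by_cases h : i ∈ D
      · have := congrFun hgg ⟨i, h⟩
        exact Prod.ext_iff.1 this
      · rw [(hmem g i h).1, (hmem g i h).2, (hmem g' i h).1, (hmem g' i h).2]
        exact ⟨rfl, rfl⟩
    refine Subtype.ext (Prod.ext (Equiv.ext fun i => (hi i).1) ?_)
    exact funext fun i => Units.ext (hi i).2
  refine (Nat.card_le_card_of_injective _ hinj).trans_eq ?_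
  rw [Nat.card_fun, Nat.card_prod]
  simp

open Classical in
lemma sum_pow_card_displaced_le [Fintype F] (c : F) {β : ℝ} (hβ : 0 ≤ β) :
    ∑ g : Equiv.Perm (Fin n) × (Fin n → Fˣ) with (displaced g.1 g.2 c).Nonempty,
      β ^ (displaced g.1 g.2 c).card ≤ (1 + n * Nat.card F * β) ^ n - 1 := by
  have h1 : ∑ g : Equiv.Perm (Fin n) × (Fin n → Fˣ) with (displaced g.1 g.2 c).Nonempty,
      β ^ (displaced g.1 g.2 c).card =
      ∑ D ∈ (Finset.univ : Finset (Finset (Fin n))).erase ∅,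
        Nat.card {g : Equiv.Perm (Fin n) × (Fin n → Fˣ) // displaced g.1 g.2 c = D} *
          β ^ D.card := by
    rw [← Finset.sum_fiberwise_of_maps_to (t := (Finset.univ : Finset (Finset (Fin n))).erase ∅)
      (g := fun g => displaced g.1 g.2 c)]
    · refine Finset.sum_congr rfl fun D hD => ?_
      rw [Finset.sum_congr rfl (g := fun _ => β ^ D.card)
        (fun g hg => by rw [(Finset.mem_filter.1 hg).2]), Finset.sum_const, nsmul_eq_mul,
        Nat.card_eq_fintype_card, Fintype.card_subtype, Finset.filter_filter]
      congr 3
      ext g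
      simp only [Finset.mem_filter, Finset.mem_univ, true_and, and_iff_right_iff_imp]
      rintro rfl
      exact Finset.nonempty_iff_ne_empty.2 (Finset.ne_of_mem_erase hD)
    · intro g hg
      exact Finset.mem_erase.2 ⟨(Finset.mem_filter.1 hg).2.ne_empty, Finset.mem_univ _⟩
  have h2 : ∑ D : Finset (Fin n), ((n * Nat.card F * β : ℝ)) ^ D.card
      = (1 + n * Nat.card F * β) ^ n := by
    have := Finset.sum_pow_mul_eq_add_pow (n * Nat.card F * β : ℝ) 1
      (Finset.univ : Finset (Fin n))
    simpa [add_comm] using this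
  rw [h1, ← h2, ← Finset.sum_erase_add _ _ (Finset.mem_univ ∅), Finset.card_empty, pow_zero,
    add_sub_cancel_right]
  refine Finset.sum_le_sum fun D _ => ?_
  rw [mul_pow]
  gcongr
  exact_mod_cast card_displaced_eq_le c D

end Monomial

section Estimates

open Module

variable {F : Type*} [Field F] {n : ℕ}

lemma ncard_invariant_semimonomial_le_of_ne_refl [Finite F] {k : ℕ} (hn : 64 ≤ n)
    (hk1 : 7 * n ≤ 16 * k) (hk2 : 16 * k ≤ 9 * n) {σ : F ≃+* F} (hσ : σ ≠ RingEquiv.refl F)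
    (π : Equiv.Perm (Fin n)) (d : Fin n → Fˣ) :
    ({W : Submodule F (Fin n → F) | finrank F W = k ∧ ∀ x ∈ W, semimonomial σ π d x ∈ W}.ncard : ℝ)
      ≤ 4 * (4 / (Nat.card F : ℝ) ^ (n / 64)) ^ n * (Nat.card F : ℝ) ^ (k * (n - k)) := by
  have hq := two_le_natCard_cast F
  have h := ncard_invariant_le_of_semilinear (semimonomial σ π d : (Fin n → F) →+ (Fin n → F))
    (semimonomial σ π d).injective σ hσ (semimonomial_smul σ π d) (k := k) (r := n / 8)
    (by rw [Module.finrank_fin_fun]; omega) (by omega)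
  rw [Module.finrank_fin_fun] at h
  refine h.trans ?_
  set q : ℝ := (Nat.card F : ℝ)
  have hq0 : 0 < q := by linarith
  set L := n / 64 with hL
  set r := n / 8 with hr
  have hexp : (n - k) * r + (k - 2 * r) * (n - k) + L * n ≤ k * (n - k) := by
    obtain ⟨m, hm⟩ : ∃ m, m = n - k := ⟨_, rfl⟩
    obtain ⟨e, he⟩ : ∃ e, k = 2 * r + e := ⟨k - 2 * r, by omega⟩
    have hLr : L * n ≤ r * m := by
      calc L * n ≤ L * (3 * m) := Nat.mul_le_mul_left _ (by omega)
        _ = (3 * L) * m := by ring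
        _ ≤ r * m := Nat.mul_le_mul_right _ (by omega)
    rw [← hm, he, Nat.add_sub_cancel_left]
    nlinarith
  have h4 : (4 : ℝ) ^ r ≤ 4 ^ n := pow_le_pow_right₀ (by norm_num) (by omega)
  have h5 : q ^ ((n - k) * r + (k - 2 * r) * (n - k)) * q ^ (L * n) ≤ q ^ (k * (n - k)) := by
    rw [← pow_add]
    exact pow_le_pow_right₀ (by linarith) hexp
  rw [div_pow, ← pow_mul, mul_pow, ← pow_mul, mul_div_assoc', div_mul_eq_mul_div,
    le_div_iff₀ (by positivity)]
  calc _ = 4 * 4 ^ r * (q ^ ((n - k) * r + (k - 2 * r) * (n - k)) * q ^ (L * n)) := by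
        rw [pow_add]; ring
    _ ≤ 4 * 4 ^ n * q ^ (k * (n - k)) := by gcongr

lemma ncard_invariant_monomialEnd_le [Finite F] {k t : ℕ} (hn : 64 ≤ n)
    (hk1 : 7 * n ≤ 16 * k) (hk2 : 16 * k ≤ 9 * n) (π : Equiv.Perm (Fin n)) (d : Fin n → Fˣ)
    (htn : t ≤ n) (ht : ∀ c, t ≤ (displaced π d c).card) :
    ({W : Submodule F (Fin n → F) | finrank F W = k ∧ ∀ x ∈ W, monomialEnd π d x ∈ W}.ncard : ℝ)
      ≤ 16 * (1 + Nat.card F) * (2 / (Nat.card F : ℝ) ^ (n / 64)) ^ t *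
        (Nat.card F : ℝ) ^ (k * (n - k)) := by
  have hq := two_le_natCard_cast F
  set s := (t + 1) / 2 with hs
  set r := s / 8 with hr
  have h := ncard_invariant_le_of_eigenspace (monomialEnd π d) (k := k) (r := r) (u := n - s)
    (by rw [Module.finrank_fin_fun]; omega) (by omega)
    (fun c => by
      have h1 := finrank_eigenspace_monomialEnd_le π d c
      have h2 := ht c
      omega) (by omega)
  rw [Module.finrank_fin_fun] at h
  refine h.trans ?_
  set q : ℝ := (Nat.card F : ℝ)
  have hq0 : 0 < q := by linarith
  set L := n / 64 with hL
  obtain ⟨m, hm⟩ : ∃ m, n = k + m := ⟨n - k, by omega⟩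
  have hnk : n - k = m := by omega
  rw [hnk]
  have e1 : m * (r + 1) + (k - 2 * (r + 1)) * m + L * t ≤ k * m := by
    obtain ⟨e, he⟩ : ∃ e, k = 2 * (r + 1) + e := ⟨k - 2 * (r + 1), by omega⟩
    rw [he, Nat.add_sub_cancel_left]
    have h1 : L * t ≤ (r + 1) * m := by
      calc L * t ≤ L * (16 * (r + 1)) := Nat.mul_le_mul_left _ (by omega)
        _ = (r + 1) * (16 * L) := by ring
        _ ≤ (r + 1) * m := Nat.mul_le_mul_left _ (by omega)
    nlinarith
  have e2 : (k - 2 * r) * (n - s - (k - 2 * r)) + 2 * r * m + L * t ≤ k * m := by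
    obtain ⟨e, he⟩ : ∃ e, k = 2 * r + e := ⟨k - 2 * r, by omega⟩
    obtain ⟨f, hf⟩ : ∃ f, n - s = e + f := ⟨n - s - e, by omega⟩
    rw [he, Nat.add_sub_cancel_left, hf, Nat.add_sub_cancel_left]
    have h1 : L * t ≤ e * (m - f) := by
      calc L * t ≤ L * (4 * (m - f)) := Nat.mul_le_mul_left _ (by omega)
        _ = (4 * L) * (m - f) := by ring
        _ ≤ e * (m - f) := Nat.mul_le_mul_right _ (by omega)
    obtain ⟨g, hg⟩ : ∃ g, m = f + g := ⟨m - f, by omega⟩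
    rw [hg, Nat.add_sub_cancel_left] at h1
    rw [hg]
    nlinarith
  have h1 : (4 : ℝ) ^ (r + 1) ≤ 4 * 2 ^ t := by
    rw [pow_succ, mul_comm, show (4 : ℝ) = 2 ^ 2 by norm_num, ← pow_mul]
    gcongr
    · norm_num
    · omega
  have h2 : (1 : ℝ) ≤ 2 ^ t := one_le_pow₀ (by norm_num)
  have g1 : q ^ (m * (r + 1) + (k - 2 * (r + 1)) * m) * q ^ (L * t) ≤ q ^ (k * m) := by
    rw [← pow_add]
    exact pow_le_pow_right₀ (by linarith) e1
  have g2 : q ^ ((k - 2 * r) * (n - s - (k - 2 * r)) + 2 * r * m) * q ^ (L * t) ≤ q ^ (k * m) := by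
    rw [← pow_add]
    exact pow_le_pow_right₀ (by linarith) e2
  rw [div_pow, ← pow_mul, mul_pow, ← pow_mul, mul_div_assoc', div_mul_eq_mul_div,
    le_div_iff₀ (by positivity)]
  calc _ = 4 ^ (r + 1) * 4 * (q ^ (m * (r + 1) + (k - 2 * (r + 1)) * m) * q ^ (L * t)) +
        q * 16 * 1 * (q ^ ((k - 2 * r) * (n - s - (k - 2 * r)) + 2 * r * m) * q ^ (L * t)) := by
        rw [pow_add q (m * (r + 1))]; ring
    _ ≤ 4 * 2 ^ t * 4 * q ^ (k * m) + q * 16 * 2 ^ t * q ^ (k * m) := by gcongr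
    _ = _ := by ring

lemma ncard_invariant_monomialEnd_le_sum [Fintype F] {k : ℕ} (hn : 64 ≤ n)
    (hk1 : 7 * n ≤ 16 * k) (hk2 : 16 * k ≤ 9 * n) (π : Equiv.Perm (Fin n)) (d : Fin n → Fˣ) :
    ({W : Submodule F (Fin n → F) | finrank F W = k ∧ ∀ x ∈ W, monomialEnd π d x ∈ W}.ncard : ℝ)
      ≤ 16 * (1 + Nat.card F) *
        (∑ c : F, (2 / (Nat.card F : ℝ) ^ (n / 64)) ^ (displaced π d c).card) *
        (Nat.card F : ℝ) ^ (k * (n - k)) := by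
  obtain ⟨c, -, hc⟩ := Finset.exists_min_image (Finset.univ : Finset F)
    (fun c => (displaced π d c).card) Finset.univ_nonempty
  refine (ncard_invariant_monomialEnd_le hn hk1 hk2 π d (t := (displaced π d c).card)
    (by simpa using Finset.card_le_univ (displaced π d c))
    fun e => hc e (Finset.mem_univ _)).trans ?_
  gcongr
  exact Finset.single_le_sum
    (f := fun c => (2 / (Nat.card F : ℝ) ^ (n / 64)) ^ (displaced π d c).card)
    (fun _ _ => by positivity) (Finset.mem_univ c)

end Estimates

/-! ### The semilinear monomial group -/

section Burnside

open Module

variable {F : Type} [Field F] {n : ℕ}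

lemma semimonomial_mul (σ σ' : F ≃+* F) (π π' : Equiv.Perm (Fin n)) (d d' : Fin n → Fˣ)
    (x : Fin n → F) :
    semimonomial σ π d (semimonomial σ' π' d' x) = semimonomial (σ'.trans σ) (π.trans π')
      (fun i => d i * Units.map (σ : F →* F) (d' (π i))) x := by
  ext i
  simp [mul_assoc]

lemma semimonomial_symm (σ : F ≃+* F) (π : Equiv.Perm (Fin n)) (d : Fin n → Fˣ) (x : Fin n → F) :
    (semimonomial σ π d).symm x = semimonomial σ.symm π.symm
      (fun i => Units.map (σ.symm : F →* F) (d (π.symm i))⁻¹) x := by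
  rw [AddEquiv.symm_apply_eq]
  ext i
  simp

lemma semimonomial_refl_one (x : Fin n → F) :
    semimonomial (RingEquiv.refl F) (Equiv.refl (Fin n)) 1 x = x := by
  ext i
  simp

variable (F n) in
/-- The group of semilinear monomial maps. -/
def semimonomialGroup : Subgroup (Equiv.Perm (Fin n → F)) where
  carrier := {g | ∃ σ π d, g = (semimonomial σ π d).toEquiv}
  mul_mem' := by
    rintro _ _ ⟨σ, π, d, rfl⟩ ⟨σ', π', d', rfl⟩
    exact ⟨_, _, _, Equiv.ext (semimonomial_mul σ σ' π π' d d')⟩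
  one_mem' := ⟨_, _, _, Equiv.ext fun x => (semimonomial_refl_one x).symm⟩
  inv_mem' := by
    rintro _ ⟨σ, π, d, rfl⟩
    exact ⟨_, _, _, Equiv.ext (semimonomial_symm σ π d)⟩

lemma semimonomial_injective (hn : 0 < n) {σ σ' : F ≃+* F} {π π' : Equiv.Perm (Fin n)}
    {d d' : Fin n → Fˣ} (h : ∀ x, semimonomial σ π d x = semimonomial σ' π' d' x) :
    σ = σ' ∧ π = π' ∧ d = d' := by
  have happ : ∀ (x : Fin n → F) (i : Fin n), (d i : F) * σ (x (π i)) = d' i * σ' (x (π' i)) := fun x i =>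
    congrFun (h x) i
  have hd : d = d' := by
    funext i
    exact Units.ext (by simpa using happ 1 i)
  subst hd
  refine ⟨RingEquiv.ext fun a => ?_, Equiv.ext fun i => ?_, rfl⟩
  · simpa using happ (fun _ => a) ⟨0, hn⟩
  · by_contra hne
    have := happ (Pi.single (π i) 1) i
    rw [Pi.single_eq_same, Pi.single_eq_of_ne (Ne.symm hne)] at this
    simp at this

lemma exists_eq_of_mem_monomialGroup {M : GL (Fin n) F} (hM : M ∈ MonomialGroup F n) :
    ∃ (π : Equiv.Perm (Fin n)) (d : Fin n → Fˣ), ∀ x,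
      (M : Matrix (Fin n) (Fin n) F) *ᵥ x = semimonomial (RingEquiv.refl F) π d x := by
  induction hM using Subgroup.closure_induction with
  | mem M hM =>
    rcases hM with ⟨π, hπ⟩ | ⟨d, hd⟩
    · exact ⟨π, 1, fun x => by rw [hπ]; ext i; simp [Matrix.permMatrix_mulVec]⟩
    · have hu : IsUnit (Matrix.diagonal d) := hd ▸ M.isUnit
      rw [Matrix.isUnit_diagonal] at hu
      refine ⟨Equiv.refl _, fun i => (hu.apply i).unit, fun x => ?_⟩
      rw [hd]
      ext i
      simp [Matrix.mulVec_diagonal]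
  | one => exact ⟨Equiv.refl _, 1, fun x => by ext i; simp⟩
  | mul M N _ _ hM hN =>
    obtain ⟨π, d, h⟩ := hM
    obtain ⟨π', d', h'⟩ := hN
    refine ⟨π.trans π', fun i => d i * d' (π i), fun x => ?_⟩
    rw [Units.val_mul, ← Matrix.mulVec_mulVec, h', h]
    ext i
    simp [mul_assoc]
  | inv M _ hM =>
    obtain ⟨π, d, h⟩ := hM
    refine ⟨π.symm, fun i => (d (π.symm i))⁻¹, fun x => ?_⟩
    obtain ⟨y, rfl⟩ := (semimonomial (RingEquiv.refl F) π d).surjective x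
    rw [← h, Matrix.mulVec_mulVec, ← Units.val_mul, inv_mul_cancel, Units.val_one,
      Matrix.one_mulVec, h]
    ext i
    simp

lemma exists_mem_monomialGroup (π : Equiv.Perm (Fin n)) (d : Fin n → Fˣ) :
    ∃ M ∈ MonomialGroup F n, ∀ x,
      (M : Matrix (Fin n) (Fin n) F) *ᵥ x = semimonomial (RingEquiv.refl F) π d x := by
  have hP : IsUnit (π.permMatrix F) := by
    rw [Matrix.isUnit_iff_isUnit_det, Matrix.det_permutation]
    exact (Units.map (Int.castRingHom F : ℤ →* F) (Equiv.Perm.sign π)).isUnit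
  have hD : IsUnit (Matrix.diagonal fun i => (d i : F)) :=
    Matrix.isUnit_diagonal.2 (Pi.isUnit_iff.2 fun i => (d i).isUnit)
  refine ⟨hD.unit * hP.unit, mul_mem (Subgroup.subset_closure (Or.inr ⟨_, rfl⟩))
    (Subgroup.subset_closure (Or.inl ⟨π, rfl⟩)), fun x => ?_⟩
  rw [Units.val_mul, IsUnit.unit_spec, IsUnit.unit_spec, ← Matrix.mulVec_mulVec]
  ext i
  simp [Matrix.mulVec_diagonal, Matrix.permMatrix_mulVec]

lemma semiRel_iff (V W : Submodule F (Fin n → F)) :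
    semiRel F n V W ↔ ∃ g ∈ semimonomialGroup F n, (W : Set (Fin n → F)) = g '' V := by
  constructor
  · rintro ⟨σ, M, hM, hW⟩
    obtain ⟨π, d, h⟩ := exists_eq_of_mem_monomialGroup hM
    refine ⟨_, ⟨σ, π, d, rfl⟩, hW.trans (Set.image_congr fun x _ => ?_)⟩
    rw [h]
    rfl
  · rintro ⟨_, ⟨σ, π, d, rfl⟩, hW⟩
    obtain ⟨M, hM, h⟩ := exists_mem_monomialGroup π d
    refine ⟨σ, M, hM, hW.trans (Set.image_congr fun x _ => ?_)⟩
    rw [h]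
    rfl

/-- The image of a subspace under a semilinear monomial map. -/
def semimonomialImage (g : semimonomialGroup F n) (V : Submodule F (Fin n → F)) :
    Submodule F (Fin n → F) where
  carrier := g.1 '' V
  add_mem' := by
    obtain ⟨_, σ, π, d, rfl⟩ := g
    rintro _ _ ⟨x, hx, rfl⟩ ⟨y, hy, rfl⟩
    exact ⟨x + y, V.add_mem hx hy, map_add (semimonomial σ π d) _ _⟩
  zero_mem' := by
    obtain ⟨_, σ, π, d, rfl⟩ := g
    exact ⟨0, V.zero_mem, map_zero (semimonomial σ π d)⟩
  smul_mem' := by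
    obtain ⟨_, σ, π, d, rfl⟩ := g
    rintro a _ ⟨x, hx, rfl⟩
    refine ⟨σ.symm a • x, V.smul_mem _ hx, (semimonomial_smul σ π d _ x).trans ?_⟩
    rw [σ.apply_symm_apply]
    rfl

lemma coe_semimonomialImage (g : semimonomialGroup F n) (V : Submodule F (Fin n → F)) :
    (semimonomialImage g V : Set (Fin n → F)) = g.1 '' V := rfl

lemma finrank_semimonomialImage [Finite F] (g : semimonomialGroup F n)
    (V : Submodule F (Fin n → F)) : finrank F (semimonomialImage g V) = finrank F V := by
  apply Nat.pow_right_injective (Finite.one_lt_card (α := F))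
  change Nat.card F ^ _ = Nat.card F ^ _
  rw [← Submodule.ncard_coe, ← Submodule.ncard_coe, coe_semimonomialImage,
    Set.ncard_image_of_injective _ g.1.injective]

/-- The action of the semilinear monomial group on the Grassmannian. -/
instance grassmannianAction [Finite F] (k : ℕ) :
    MulAction (semimonomialGroup F n) {V : Submodule F (Fin n → F) // finrank F V = k} where
  smul g V := ⟨semimonomialImage g V.1, (finrank_semimonomialImage g V.1).trans V.2⟩
  one_smul _ := Subtype.ext (SetLike.coe_injective (Set.image_id _))
  mul_smul g h _ := Subtype.ext (SetLike.coe_injective (Set.image_comp g.1 h.1 _))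

lemma coe_grassmannianAction_smul [Finite F] {k : ℕ} (g : semimonomialGroup F n)
    (V : {V : Submodule F (Fin n → F) // finrank F V = k}) :
    ((g • V).1 : Set (Fin n → F)) = g.1 '' V.1 := rfl

lemma numClassesDimSemi_eq_card_orbits [Finite F] (k : ℕ) :
    numClassesDimSemi F n k = Nat.card (Quotient (MulAction.orbitRel (semimonomialGroup F n)
      {V : Submodule F (Fin n → F) // finrank F V = k})) := by
  refine Nat.card_congr (Quot.congrRight fun V W => ?_)
  rw [semiRel_iff]
  rw [MulAction.orbitRel_apply, MulAction.mem_orbit_symm]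
  constructor
  · rintro ⟨g, hg, h⟩
    exact ⟨⟨g, hg⟩, Subtype.ext (SetLike.coe_injective h.symm)⟩
  · rintro ⟨g, rfl⟩
    exact ⟨g.1, g.2, rfl⟩

lemma card_fixedBy [Finite F] (k : ℕ) (g : semimonomialGroup F n) :
    Nat.card (MulAction.fixedBy {V : Submodule F (Fin n → F) // finrank F V = k} g) =
      {W : Submodule F (Fin n → F) | finrank F W = k ∧ ∀ x ∈ W, g.1 x ∈ W}.ncard := by
  rw [Nat.card_coe_set_eq, ← Set.ncard_image_of_injective _ Subtype.val_injective]
  congr 1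
  ext W
  constructor
  · rintro ⟨V, hV, rfl⟩
    refine ⟨V.2, fun x hx => ?_⟩
    have h := coe_grassmannianAction_smul g V
    rw [MulAction.mem_fixedBy.1 hV] at h
    rw [← SetLike.mem_coe, h]
    exact ⟨x, hx, rfl⟩
  · rintro ⟨hk, hW⟩
    refine ⟨⟨W, hk⟩, Subtype.ext (SetLike.coe_injective ?_), rfl⟩
    refine Set.eq_of_subset_of_ncard_le ?_ ?_
    · rintro _ ⟨x, hx, rfl⟩
      exact hW x hx
    · rw [coe_grassmannianAction_smul, Set.ncard_image_of_injective _ g.1.injective]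

open Classical in
theorem numClassesDimSemi_mul_card [Fintype F] [Fintype (F ≃+* F)] (hn : 0 < n) (k : ℕ) :
    numClassesDimSemi F n k * Nat.card ((F ≃+* F) × Equiv.Perm (Fin n) × (Fin n → Fˣ)) =
      ∑ σ : F ≃+* F, ∑ g : Equiv.Perm (Fin n) × (Fin n → Fˣ),
      {W : Submodule F (Fin n → F) |
        finrank F W = k ∧ ∀ x ∈ W, semimonomial σ g.1 g.2 x ∈ W}.ncard := by
  classical
  let e : (F ≃+* F) × Equiv.Perm (Fin n) × (Fin n → Fˣ) ≃ semimonomialGroup F n :=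
    Equiv.ofBijective (fun g => ⟨(semimonomial g.1 g.2.1 g.2.2).toEquiv, ⟨_, _, _, rfl⟩⟩) (by
      constructor
      · rintro ⟨σ, π, d⟩ ⟨σ', π', d'⟩ h
        obtain ⟨rfl, rfl, rfl⟩ := semimonomial_injective hn fun x =>
          DFunLike.congr_fun (Subtype.ext_iff.1 h) x
        rfl
      · rintro ⟨_, σ, π, d, rfl⟩
        exact ⟨⟨σ, π, d⟩, rfl⟩)
  have := Fintype.ofEquiv _ e
  have hfin : ∀ g : semimonomialGroup F n,
      Fintype (MulAction.fixedBy {V : Submodule F (Fin n → F) // finrank F V = k} g) :=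
    fun g => Fintype.ofFinite _
  have := Fintype.ofFinite (Quotient (MulAction.orbitRel (semimonomialGroup F n)
    {V : Submodule F (Fin n → F) // finrank F V = k}))
  have key := MulAction.sum_card_fixedBy_eq_card_orbits_mul_card_group (semimonomialGroup F n)
    {V : Submodule F (Fin n → F) // finrank F V = k}
  simp only [← Nat.card_eq_fintype_card, card_fixedBy] at key
  rw [numClassesDimSemi_eq_card_orbits, Nat.card_congr e, ← key, ← Fintype.sum_prod_type',
    ← e.sum_comp]
  rfl

end Burnside

/-! ### Asymptotics -/

section Asymptotics

open Module

variable {F : Type} [Field F] {n : ℕ}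

lemma natCard_ringEquiv_self [Fintype F] {p h : ℕ} (hp : p.Prime) (hF : Fintype.card F = p ^ h) :
    Nat.card (F ≃+* F) = h := by
  have := Fact.mk hp
  have : CharP F p := charP_of_card_eq_prime_pow hF
  let := ZMod.algebra F p
  let e : (F ≃+* F) ≃ (F ≃ₐ[ZMod p] F) :=
    { toFun σ := AlgEquiv.ofRingEquiv (f := σ) fun x =>
        DFunLike.congr_fun (Subsingleton.elim
          ((σ : F →+* F).comp (algebraMap (ZMod p) F)) (algebraMap (ZMod p) F)) x
      invFun σ := σ
      left_inv _ := RingEquiv.ext fun _ => rfl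
      right_inv _ := AlgEquiv.ext fun _ => rfl }
  rw [Nat.card_congr e, IsGalois.card_aut_eq_finrank]
  have h1 := Module.card_eq_pow_finrank (K := ZMod p) (V := F)
  rw [hF, ZMod.card] at h1
  exact (Nat.pow_right_injective hp.two_le h1).symm

lemma ncard_finrank_eq_qBinom [Finite F] {k : ℕ} (hk : k ≤ n) :
    ({W : Submodule F (Fin n → F) | finrank F W = k}.ncard : ℝ) = qBinom (Nat.card F) n k := by
  have hq := two_le_natCard_cast F
  have h := ncard_between (⊤ : Submodule F (Fin n → F)) k k ⊥ bot_le (by simp)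
  simp only [bot_le, le_top, true_and, finrank_top, finrank_bot, finrank_fin_fun, zero_add] at h
  rw [h, qBinom]
  refine Finset.prod_congr rfl fun j hj => ?_
  have hj := Finset.mem_range.1 hj
  have hpow : ∀ m, j ≤ m →
      (Nat.card F : ℝ) ^ m - (Nat.card F : ℝ) ^ j =
        (Nat.card F : ℝ) ^ j * ((Nat.card F : ℝ) ^ (m - j) - 1) := fun m hm => by
    rw [mul_sub, ← pow_add, mul_one, Nat.add_sub_of_le hm]
  rw [hpow n (by omega), hpow k hj.le, mul_div_mul_left _ _ (by positivity)]

lemma pow_mul_le_qBinom {q k : ℕ} (hq : 2 ≤ q) (hk : k ≤ n) :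
    (q : ℝ) ^ (k * (n - k)) ≤ qBinom q n k := by
  have hq' : (2 : ℝ) ≤ q := by exact_mod_cast hq
  calc (q : ℝ) ^ (k * (n - k)) = ∏ _j ∈ Finset.range k, (q : ℝ) ^ (n - k) := by
        rw [Finset.prod_const, Finset.card_range, ← pow_mul, mul_comm]
    _ ≤ qBinom q n k := ?_
  refine Finset.prod_le_prod (fun _ _ => by positivity) fun j hj => ?_
  have hj := Finset.mem_range.1 hj
  have h1 : (1 : ℝ) < (q : ℝ) ^ (k - j) := one_lt_pow₀ (by linarith) (by omega)
  have h2 : (1 : ℝ) ≤ (q : ℝ) ^ (n - k) := one_le_pow₀ (by linarith)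
  rw [le_div_iff₀ (by linarith), mul_sub, ← pow_add, show n - k + (k - j) = n - j by omega]
  linarith

lemma exists_forall_eq_of_displaced_eq_empty (hn : 0 < n) {π : Equiv.Perm (Fin n)}
    {d : Fin n → Fˣ} {c : F} (h : displaced π d c = ∅) :
    ∃ u : Fˣ, (Equiv.refl (Fin n), fun _ => u) = (π, d) := by
  have h' : ∀ i, π i = i ∧ (d i : F) = c := by
    intro i
    have := Finset.eq_empty_iff_forall_notMem.1 h i
    simpa [displaced] using this
  refine ⟨d ⟨0, hn⟩, Prod.ext (Equiv.ext fun i => (h' i).1.symm) (funext fun i => Units.ext ?_)⟩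
  rw [(h' i).2]
  exact (h' _).2

open Classical in
lemma sum_ncard_invariant_semimonomial_refl [Fintype F] {k : ℕ} (hn : 64 ≤ n)
    (hk1 : 7 * n ≤ 16 * k) (hk2 : 16 * k ≤ 9 * n) :
    ∃ E : ℝ, 0 ≤ E ∧ E ≤ 16 * (1 + Nat.card F) * (Nat.card F *
      ((1 + n * Nat.card F * (2 / (Nat.card F : ℝ) ^ (n / 64))) ^ n - 1)) *
        (Nat.card F : ℝ) ^ (k * (n - k)) ∧
      ∑ g : Equiv.Perm (Fin n) × (Fin n → Fˣ), ({W : Submodule F (Fin n → F) | finrank F W = k ∧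
        ∀ x ∈ W, semimonomial (RingEquiv.refl F) g.1 g.2 x ∈ W}.ncard : ℝ) =
      (Nat.card F - 1) * qBinom (Nat.card F) n k + E := by
  have hn0 : 0 < n := by omega
  have hβ : 0 ≤ 2 / (Nat.card F : ℝ) ^ (n / 64) := by positivity
  set β := 2 / (Nat.card F : ℝ) ^ (n / 64) with hβ'
  set φ : Equiv.Perm (Fin n) × (Fin n → Fˣ) → ℝ := fun g =>
    ({W : Submodule F (Fin n → F) | finrank F W = k ∧
        ∀ x ∈ W, semimonomial (RingEquiv.refl F) g.1 g.2 x ∈ W}.ncard : ℝ) with hφ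
  let s : Fˣ → Equiv.Perm (Fin n) × (Fin n → Fˣ) := fun u => (Equiv.refl _, fun _ => u)
  have hs : Function.Injective s := fun u v h => congrFun (congrArg Prod.snd h) ⟨0, hn0⟩
  set S : Finset (Equiv.Perm (Fin n) × (Fin n → Fˣ)) := Finset.univ.image s with hS
  refine ⟨∑ g ∈ Sᶜ, φ g, Finset.sum_nonneg fun _ _ => Nat.cast_nonneg _, ?_, ?_⟩
  · calc ∑ g ∈ Sᶜ, φ g
        ≤ ∑ g ∈ Sᶜ, 16 * (1 + (Nat.card F : ℝ)) *
          (∑ c : F, β ^ (displaced g.1 g.2 c).card) * (Nat.card F : ℝ) ^ (k * (n - k)) :=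
          Finset.sum_le_sum fun g _ => ncard_invariant_monomialEnd_le_sum hn hk1 hk2 g.1 g.2
      _ = 16 * (1 + (Nat.card F : ℝ)) *
          (∑ c : F, ∑ g ∈ Sᶜ, β ^ (displaced g.1 g.2 c).card) *
            (Nat.card F : ℝ) ^ (k * (n - k)) := by
          rw [Finset.sum_comm, ← Finset.sum_mul, ← Finset.mul_sum]
      _ ≤ _ := by
          gcongr
          calc ∑ c : F, ∑ g ∈ Sᶜ, β ^ (displaced g.1 g.2 c).card
              ≤ ∑ _c : F, ((1 + n * Nat.card F * β) ^ n - 1) := by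
                refine Finset.sum_le_sum fun c _ =>
                  (Finset.sum_le_sum_of_subset_of_nonneg ?_ fun _ _ _ => by positivity).trans
                    (sum_pow_card_displaced_le c hβ)
                intro g hg
                refine Finset.mem_filter.2 ⟨Finset.mem_univ _, ?_⟩
                rw [Finset.nonempty_iff_ne_empty]
                intro h
                obtain ⟨u, hu⟩ := exists_forall_eq_of_displaced_eq_empty hn0 h
                exact Finset.mem_compl.1 hg (Finset.mem_image.2 ⟨u, Finset.mem_univ _, hu⟩)
            _ = _ := by
                rw [Finset.sum_const, Finset.card_univ, nsmul_eq_mul, Nat.card_eq_fintype_card]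
  · rw [← Finset.sum_add_sum_compl S, hS, Finset.sum_image hs.injOn]
    congr 1
    have h1 : ∀ u, φ (s u) = qBinom (Nat.card F) n k := by
      intro u
      rw [← ncard_finrank_eq_qBinom (F := F) (n := n) (by omega : k ≤ n)]
      refine congrArg (fun A : Set (Submodule F (Fin n → F)) => (A.ncard : ℝ)) ?_
      ext W
      refine and_iff_left fun x hx => ?_
      convert W.smul_mem (u : F) hx using 1
      ext i
      simp [s]
    rw [Finset.sum_congr rfl fun u _ => h1 u, Finset.sum_const, Finset.card_univ, nsmul_eq_mul,
      Fintype.card_units, Nat.cast_sub Fintype.card_pos, Nat.card_eq_fintype_card, Nat.cast_one]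

/-- The error term in the orbit count, relative to `q ^ (k * (n - k))`. -/
noncomputable def orbitError (q h n : ℕ) : ℝ :=
  16 * (1 + q) * (q * ((1 + n * q * (2 / (q : ℝ) ^ (n / 64))) ^ n - 1)) +
    h * (n.factorial * ((q : ℝ) - 1) ^ n) * (4 * (4 / (q : ℝ) ^ (n / 64)) ^ n)

lemma natCard_monomial [Fintype F] :
    (Nat.card (Equiv.Perm (Fin n) × (Fin n → Fˣ)) : ℝ) =
      n.factorial * ((Nat.card F : ℝ) - 1) ^ n := by
  classical
  rw [Nat.card_prod, Nat.card_fun, Nat.card_perm, Nat.card_eq_fintype_card (α := Fˣ),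
    Fintype.card_units]
  simp [Nat.cast_sub Fintype.card_pos]

theorem exists_numClassesDimSemi_eq [Fintype F] {k : ℕ} (hn : 64 ≤ n)
    (hk1 : 7 * n ≤ 16 * k) (hk2 : 16 * k ≤ 9 * n) :
    ∃ E : ℝ, 0 ≤ E ∧
      E ≤ orbitError (Nat.card F) (Nat.card (F ≃+* F)) n * (Nat.card F : ℝ) ^ (k * (n - k)) ∧
      (numClassesDimSemi F n k : ℝ) *
        (Nat.card (F ≃+* F) * (n.factorial * ((Nat.card F : ℝ) - 1) ^ n)) =
      (Nat.card F - 1) * qBinom (Nat.card F) n k + E := by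
  classical
  have : Finite (F ≃+* F) := DFunLike.finite _
  have := Fintype.ofFinite (F ≃+* F)
  obtain ⟨E, hE0, hE, hsum⟩ := sum_ncard_invariant_semimonomial_refl (F := F) hn hk1 hk2
  have key := congrArg (Nat.cast (R := ℝ)) (numClassesDimSemi_mul_card (F := F) (by omega : 0 < n) k)
  rw [Nat.card_prod] at key
  push_cast at key
  rw [← natCard_monomial, key, ← Finset.add_sum_erase _ _ (Finset.mem_univ (RingEquiv.refl F)),
    hsum, add_assoc]
  refine ⟨_, ?_, ?_, rfl⟩
  · exact add_nonneg hE0 (Finset.sum_nonneg fun _ _ => Finset.sum_nonneg fun _ _ =>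
      Nat.cast_nonneg _)
  · rw [orbitError, add_mul]
    refine add_le_add hE ?_
    calc ∑ σ ∈ Finset.univ.erase (RingEquiv.refl F), ∑ g : Equiv.Perm (Fin n) × (Fin n → Fˣ),
          ({W : Submodule F (Fin n → F) | finrank F W = k ∧
            ∀ x ∈ W, semimonomial σ g.1 g.2 x ∈ W}.ncard : ℝ)
        ≤ ∑ σ ∈ Finset.univ.erase (RingEquiv.refl F), ∑ _g : Equiv.Perm (Fin n) × (Fin n → Fˣ),
          4 * (4 / (Nat.card F : ℝ) ^ (n / 64)) ^ n * (Nat.card F : ℝ) ^ (k * (n - k)) :=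
          Finset.sum_le_sum fun σ hσ => Finset.sum_le_sum fun g _ =>
            ncard_invariant_semimonomial_le_of_ne_refl hn hk1 hk2 (Finset.ne_of_mem_erase hσ) _ _
      _ ≤ ∑ σ : F ≃+* F, ∑ _g : Equiv.Perm (Fin n) × (Fin n → Fˣ),
          4 * (4 / (Nat.card F : ℝ) ^ (n / 64)) ^ n * (Nat.card F : ℝ) ^ (k * (n - k)) :=
          Finset.sum_le_sum_of_subset_of_nonneg (Finset.erase_subset _ _) fun _ _ _ =>
            Finset.sum_nonneg fun _ _ => by positivity
      _ = _ := by
          rw [Finset.sum_const, Finset.sum_const, Finset.card_univ, Finset.card_univ, nsmul_eq_mul,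
            nsmul_eq_mul, ← natCard_monomial, ← Nat.card_eq_fintype_card (α := F ≃+* F),
            ← Nat.card_eq_fintype_card (α := Equiv.Perm (Fin n) × (Fin n → Fˣ))]
          ring

lemma tendsto_sq_div_pow_div (q : ℕ) (hq : 2 ≤ q) :
    Tendsto (fun n : ℕ => 4 * (q : ℝ) * n ^ 2 / (q : ℝ) ^ (n / 64)) atTop (𝓝 0) := by
  have hq' : (2 : ℝ) ≤ q := by exact_mod_cast hq
  have h1 : Tendsto (fun m : ℕ => (m : ℝ) ^ 2 * (q : ℝ)⁻¹ ^ m) atTop (𝓝 0) := by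
    refine tendsto_pow_const_mul_const_pow_of_abs_lt_one 2 ?_
    rw [abs_of_nonneg (by positivity)]
    exact inv_lt_one_of_one_lt₀ (by linarith)
  have h2 : Tendsto (fun n : ℕ => 65536 * (q : ℝ) * (((n / 64 : ℕ) : ℝ) ^ 2 * (q : ℝ)⁻¹ ^ (n / 64)))
      atTop (𝓝 0) := by
    simpa using (h1.comp (Nat.tendsto_div_const_atTop (by norm_num : (64 : ℕ) ≠ 0))).const_mul
      (65536 * (q : ℝ))
  refine squeeze_zero' (Eventually.of_forall fun n => by positivity) ?_ h2
  filter_upwards [eventually_ge_atTop 64] with n hn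
  have h3 : (n : ℝ) ≤ 128 * ((n / 64 : ℕ) : ℝ) := by
    have : n ≤ 128 * (n / 64) := by omega
    exact_mod_cast this
  rw [div_eq_mul_inv, inv_pow]
  calc 4 * (q : ℝ) * n ^ 2 * ((q : ℝ) ^ (n / 64))⁻¹
      ≤ 4 * (q : ℝ) * (128 * ((n / 64 : ℕ) : ℝ)) ^ 2 * ((q : ℝ) ^ (n / 64))⁻¹ := by gcongr
    _ = _ := by ring

lemma orbitError_le {q h : ℕ} (hq : 2 ≤ q) (hn : 0 < n) {y : ℝ}
    (hy : y = 4 * (q : ℝ) * n ^ 2 / (q : ℝ) ^ (n / 64)) (hy1 : y ≤ 1) :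
    orbitError q h n ≤ 16 * (1 + q) * (q * (Real.exp y - 1)) + 4 * h * y := by
  have hq' : (2 : ℝ) ≤ q := by exact_mod_cast hq
  have hn' : (1 : ℝ) ≤ n := by exact_mod_cast hn
  have hy0 : 0 ≤ y := by rw [hy]; positivity
  rw [orbitError]
  refine add_le_add ?_ ?_
  · gcongr
    calc (1 + n * q * (2 / (q : ℝ) ^ (n / 64))) ^ n
        ≤ Real.exp (n * q * (2 / (q : ℝ) ^ (n / 64))) ^ n := by
          gcongr
          rw [add_comm]
          exact Real.add_one_le_exp _
      _ = Real.exp (y / 2) := by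
          rw [← Real.exp_nat_mul, hy]
          congr 1
          ring
      _ ≤ Real.exp y := Real.exp_le_exp.2 (by linarith)
  · have h1 : (n.factorial : ℝ) ≤ (n : ℝ) ^ n := by exact_mod_cast Nat.factorial_le_pow n
    have h2 : 4 * (q : ℝ) * n / (q : ℝ) ^ (n / 64) ≤ y := by
      rw [hy]
      gcongr
      nlinarith
    have h3 : (0 : ℝ) ≤ (q : ℝ) - 1 := by linarith
    calc h * (n.factorial * ((q : ℝ) - 1) ^ n) * (4 * (4 / (q : ℝ) ^ (n / 64)) ^ n)
        ≤ h * ((n : ℝ) ^ n * (q : ℝ) ^ n) * (4 * (4 / (q : ℝ) ^ (n / 64)) ^ n) := by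
          gcongr
          linarith
      _ = 4 * h * (4 * (q : ℝ) * n / (q : ℝ) ^ (n / 64)) ^ n := by
          rw [div_pow, div_pow, mul_pow, mul_pow]
          ring
      _ ≤ 4 * h * y ^ n := by gcongr
      _ ≤ 4 * h * y := by
          gcongr
          exact pow_le_of_le_one hy0 hy1 hn.ne'

lemma orbitError_nonneg {q h : ℕ} (hq : 2 ≤ q) : 0 ≤ orbitError q h n := by
  have hq' : (2 : ℝ) ≤ q := by exact_mod_cast hq
  have h1 : (1 : ℝ) ≤ (1 + n * q * (2 / (q : ℝ) ^ (n / 64))) ^ n :=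
    one_le_pow₀ (le_add_of_nonneg_right (by positivity))
  have h2 : (0 : ℝ) ≤ (1 + n * q * (2 / (q : ℝ) ^ (n / 64))) ^ n - 1 := by linarith
  have h3 : (0 : ℝ) ≤ (q : ℝ) - 1 := by linarith
  rw [orbitError]
  positivity

lemma tendsto_orbitError {q h : ℕ} (hq : 2 ≤ q) :
    Tendsto (fun n => orbitError q h n) atTop (𝓝 0) := by
  have hy := tendsto_sq_div_pow_div q hq
  have hlim : Tendsto (fun y : ℝ => 16 * (1 + (q : ℝ)) * (q * (Real.exp y - 1)) + 4 * h * y)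
      (𝓝 0) (𝓝 0) := by
    refine Continuous.tendsto' (by fun_prop) _ _ (by simp)
  refine squeeze_zero' (Eventually.of_forall fun n => orbitError_nonneg hq) ?_ (hlim.comp hy)
  filter_upwards [eventually_gt_atTop 0, hy.eventually_le_const one_pos] with n hn hn1
  exact orbitError_le hq hn rfl hn1

lemma StarCond.eventually_bounds {k : ℕ → ℕ} (h : StarCond 1 (1 / 256) k) :
    ∀ᶠ n in atTop, 64 ≤ n ∧ 7 * n ≤ 16 * k n ∧ 16 * k n ≤ 9 * n := by
  filter_upwards [eventually_ge_atTop 64, h.eventually_le_atBot 0] with n hn hle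
  have hn' : (64 : ℝ) ≤ n := by exact_mod_cast hn
  have h1 : ((k n : ℝ) - n / 2) ^ 2 ≤ ((n : ℝ) / 16) ^ 2 := by
    nlinarith [Real.sqrt_nonneg (n : ℝ)]
  have h2 := abs_le_of_sq_le_sq' h1 (by positivity)
  refine ⟨hn, ?_, ?_⟩
  · have : (7 * n : ℝ) ≤ 16 * k n := by linarith [h2.1]
    exact_mod_cast this
  · have : (16 * k n : ℝ) ≤ 9 * n := by linarith [h2.2]
    exact_mod_cast this

end Asymptotics

theorem stmt4 (q p h : ℕ) (hp : p.Prime) (hh : 1 ≤ h) (hqph : q = p ^ h)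
    (F : Type) [Field F] [Fintype F] (hq : Fintype.card F = q) :
    ∃ A > (0 : ℝ), ∃ ε > (0 : ℝ), ∀ k : ℕ → ℕ, (∀ n, k n ≤ n) → StarCond A ε k →
      Tendsto (fun n : ℕ => (numClassesDimSemi F n (k n) : ℝ) /
          (qBinom q n (k n) / ((h : ℝ) * (n.factorial : ℝ) * ((q : ℝ) - 1) ^ (n - 1))))
        atTop (𝓝 1) := by
  refine ⟨1, one_pos, 1 / 256, by norm_num, fun k hk hstar => ?_⟩
  have haut : Nat.card (F ≃+* F) = h := natCard_ringEquiv_self hp (hq.trans hqph)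
  have hcard : Nat.card F = q := Nat.card_eq_fintype_card.trans hq
  have hq2 : 2 ≤ q := hq ▸ Fintype.one_lt_card
  have hq' : (2 : ℝ) ≤ q := by exact_mod_cast hq2
  have hlim : Tendsto (fun n => 1 + orbitError q h n) atTop (𝓝 1) := by
    simpa using (tendsto_orbitError (h := h) hq2).const_add 1
  refine tendsto_of_tendsto_of_tendsto_of_le_of_le' tendsto_const_nhds hlim ?_ ?_ <;>
  filter_upwards [hstar.eventually_bounds] with n hn
  all_goals
    obtain ⟨E, hE0, hE, hN⟩ := exists_numClassesDimSemi_eq (F := F) hn.1 hn.2.1 hn.2.2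
    rw [haut, hcard] at hE hN
    have hB := pow_mul_le_qBinom hq2 (hk n)
    have hP : 0 < (q : ℝ) ^ (k n * (n - k n)) := by positivity
    have hq1 : (1 : ℝ) ≤ (q : ℝ) - 1 := by linarith
    have hpow : ((q : ℝ) - 1) ^ n = ((q : ℝ) - 1) ^ (n - 1) * (q - 1) := by
      rw [← pow_succ, Nat.sub_add_cancel (by omega)]
    have hM : 0 < (h : ℝ) * n.factorial * ((q : ℝ) - 1) ^ (n - 1) := by positivity
    have hB0 : 0 < qBinom q n (k n) := hP.trans_le hB
    rw [hpow] at hN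
    rw [div_div_eq_mul_div]
  · rw [one_le_div hB0]
    nlinarith
  · rw [div_le_iff₀ hB0]
    have h0 := orbitError_nonneg (n := n) (h := h) hq2
    have h1 : E ≤ ((q : ℝ) - 1) * (orbitError q h n * qBinom q n (k n)) := by
      calc E ≤ orbitError q h n * qBinom q n (k n) := hE.trans (by gcongr)
        _ ≤ _ := le_mul_of_one_le_left (by positivity) hq1
    nlinarith
end
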